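/- Let μ be a nontrivial probability measure on the unit circle satisfying the Nevai condition α_n(μ) → 0, and let g : ∂𝔻 → ℝ be a Lipschitz continuous, strictly positive function. If μ has normal L²-derivative behavior, then the measure g·dμ (with density g with respect to μ) also has normal L²-derivative behavior. -/

import Mathlib

open MeasureTheory Polynomial Filter Topology ComplexConjugate

noncomputable section

/-- The reversed (Szegő `*`-transformed) polynomial of a degree-`n` polynomial:
`P*(z) = z^n conj(P(1/conj z))`, i.e. the coefficients are conjugated and reversed. -/
def starPoly (n : ℕ) (P : Polynomial ℂ) : Polynomial ℂ :=
  (P.map (starRingEnd ℂ)).reflect n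

/-- The `L²(dμ)` norm of a polynomial. -/
def l2norm (μ : Measure ℂ) (P : Polynomial ℂ) : ℝ :=
  (∫ z, ‖P.eval z‖ ^ 2 ∂μ) ^ (1 / 2 : ℝ)

/-- `φ` is the sequence of orthonormal polynomials for the measure `μ`:
`φ n` has degree `n`, a positive (real) leading coefficient, and the family
is orthonormal in `L²(dμ)`. -/
structure IsOPUC (μ : Measure ℂ) (φ : ℕ → Polynomial ℂ) : Prop where
  deg : ∀ n : ℕ, (φ n).degree = n
  lead_re_pos : ∀ n : ℕ, 0 < ((φ n).leadingCoeff).re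
  lead_im_zero : ∀ n : ℕ, ((φ n).leadingCoeff).im = 0
  orth : ∀ m n : ℕ,
    ∫ z, conj ((φ m).eval z) * (φ n).eval z ∂μ = if m = n then 1 else 0

/-- The monic orthogonal polynomials `Φ_n` associated to the orthonormal ones. -/
def monicOP (φ : ℕ → Polynomial ℂ) (n : ℕ) : Polynomial ℂ :=
  Polynomial.C ((φ n).leadingCoeff)⁻¹ * φ n

/-- The Verblunsky coefficients `α_n = -conj (Φ_{n+1}(0))`. -/
def verblunsky (φ : ℕ → Polynomial ℂ) (n : ℕ) : ℂ :=
  -conj ((monicOP φ (n + 1)).eval 0)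

/-- The measure lives on the unit circle `∂𝔻`. -/
def OnCircle (μ : Measure ℂ) : Prop := μ (Metric.sphere (0 : ℂ) 1)ᶜ = 0

/-- The measure is nontrivial: it is not supported on any finite set
(equivalently, its support is infinite). -/
def NontrivialSupport (μ : Measure ℂ) : Prop :=
  ∀ s : Finset ℂ, μ ((↑s : Set ℂ))ᶜ ≠ 0

/-- `μ` has normal `L²`-derivative behavior: `‖φ_n'‖_{L²(dμ)} / n → 1`. -/
def NormalBehavior (μ : Measure ℂ) (φ : ℕ → Polynomial ℂ) : Prop :=
  Tendsto (fun n : ℕ => l2norm μ (derivative (φ n)) / n) atTop (𝓝 1)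

namespace OPH

set_option linter.unusedSectionVars false

/-- measurable and bounded on the circle -/
def Nice (f : ℂ → ℂ) : Prop := Measurable f ∧ ∃ C : ℝ, ∀ z, ‖z‖ = 1 → ‖f z‖ ≤ C

lemma Nice.add {f g : ℂ → ℂ} (hf : Nice f) (hg : Nice g) : Nice (fun z => f z + g z) := by
  obtain ⟨h1, C, hC⟩ := hf
  obtain ⟨h2, D, hD⟩ := hg
  exact ⟨h1.add h2, C + D, fun z hz => (norm_add_le _ _).trans (add_le_add (hC z hz) (hD z hz))⟩

lemma Nice.sub {f g : ℂ → ℂ} (hf : Nice f) (hg : Nice g) : Nice (fun z => f z - g z) := by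
  obtain ⟨h1, C, hC⟩ := hf
  obtain ⟨h2, D, hD⟩ := hg
  exact ⟨h1.sub h2, C + D, fun z hz => (norm_sub_le _ _).trans (add_le_add (hC z hz) (hD z hz))⟩

lemma Nice.mul {f g : ℂ → ℂ} (hf : Nice f) (hg : Nice g) : Nice (fun z => f z * g z) := by
  obtain ⟨h1, C, hC⟩ := hf
  obtain ⟨h2, D, hD⟩ := hg
  refine ⟨h1.mul h2, C * D, fun z hz => ?_⟩
  rw [norm_mul]
  exact mul_le_mul (hC z hz) (hD z hz) (norm_nonneg _) ((norm_nonneg _).trans (hC z hz))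

lemma Nice.conj {f : ℂ → ℂ} (hf : Nice f) : Nice (fun z => conj (f z)) := by
  obtain ⟨h1, C, hC⟩ := hf
  refine ⟨Complex.continuous_conj.measurable.comp h1, C, fun z hz => ?_⟩
  rw [RCLike.norm_conj]; exact hC z hz

lemma Nice.of_cont {f : ℂ → ℂ} (hf : Continuous f) : Nice f := by
  refine ⟨hf.measurable, ?_⟩
  obtain ⟨C, hC⟩ := (isCompact_sphere (0 : ℂ) 1).exists_bound_of_continuousOn hf.continuousOn
  exact ⟨C, fun z hz => hC z (by simpa using hz)⟩

lemma Nice.const (c : ℂ) : Nice (fun _ => c) := Nice.of_cont continuous_const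

lemma Nice.poly (P : ℂ[X]) : Nice (fun z => P.eval z) := Nice.of_cont P.continuous

lemma Nice.sum {ι : Type*} (s : Finset ι) {f : ι → ℂ → ℂ} (h : ∀ i ∈ s, Nice (f i)) :
    Nice (fun z => ∑ i ∈ s, f i z) := by
  classical
  induction s using Finset.induction_on with
  | empty => simpa using Nice.const 0
  | insert a s ha ih =>
    simp only [Finset.sum_insert ha]
    exact (h a (by simp)).add (ih fun i hi => h i (by simp [hi]))

variable {μ : Measure ℂ} [IsProbabilityMeasure μ]

lemma Nice.bddae {f : ℂ → ℂ} (hf : Nice f) (hS : ∀ᵐ z ∂μ, ‖z‖ = 1) (p : ENNReal) :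
    MemLp f p μ := by
  obtain ⟨h1, C, hC⟩ := hf
  exact MemLp.of_bound h1.aestronglyMeasurable C (hS.mono fun z hz => hC z hz)

lemma Nice.int {f : ℂ → ℂ} (hf : Nice f) (hS : ∀ᵐ z ∂μ, ‖z‖ = 1) : Integrable f μ :=
  memLp_one_iff_integrable.1 (hf.bddae hS 1)

lemma Nice.int_norm_mul {f g : ℂ → ℂ} (hf : Nice f) (hg : Nice g) (hS : ∀ᵐ z ∂μ, ‖z‖ = 1) :
    Integrable (fun z => ‖f z‖ * ‖g z‖) μ := by
  have := ((hf.mul hg).int hS).norm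
  simpa using this

lemma Nice.int_sq {f : ℂ → ℂ} (hf : Nice f) (hS : ∀ᵐ z ∂μ, ‖z‖ = 1) :
    Integrable (fun z => ‖f z‖ ^ 2) μ := by
  have := hf.int_norm_mul hf hS
  simpa [sq] using this

/-- the `L²` norm of a function -/
def N (μ : Measure ℂ) (f : ℂ → ℂ) : ℝ := Real.sqrt (∫ z, ‖f z‖ ^ 2 ∂μ)

lemma N_nonneg (f : ℂ → ℂ) : 0 ≤ N μ f := Real.sqrt_nonneg _

lemma N_sq (f : ℂ → ℂ) : N μ f ^ 2 = ∫ z, ‖f z‖ ^ 2 ∂μ :=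
  Real.sq_sqrt (integral_nonneg fun z => by positivity)

lemma N_cs {f g : ℂ → ℂ} (hf : Nice f) (hg : Nice g) (hS : ∀ᵐ z ∂μ, ‖z‖ = 1) :
    ∫ z, ‖f z‖ * ‖g z‖ ∂μ ≤ N μ f * N μ g := by
  have h := integral_mul_norm_le_Lp_mul_Lq (μ := μ) (f := f) (g := g) Real.HolderConjugate.two_two
    (hf.bddae hS _) (hg.bddae hS _)
  simpa [N, Real.sqrt_eq_rpow] using h

lemma N_cs' {f g : ℂ → ℂ} (hf : Nice f) (hg : Nice g) (hS : ∀ᵐ z ∂μ, ‖z‖ = 1) :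
    ‖∫ z, f z * g z ∂μ‖ ≤ N μ f * N μ g := by
  refine (norm_integral_le_integral_norm _).trans ?_
  simpa using N_cs hf hg hS

lemma N_mono {f g : ℂ → ℂ} (hg : Nice g) (hS : ∀ᵐ z ∂μ, ‖z‖ = 1) {C : ℝ} (hC : 0 ≤ C)
    (h : ∀ z, ‖z‖ = 1 → ‖f z‖ ≤ C * ‖g z‖) : N μ f ≤ C * N μ g := by
  rw [N, Real.sqrt_le_left (mul_nonneg hC (N_nonneg _)), mul_pow, N_sq, ← integral_const_mul]
  refine integral_mono_of_nonneg (ae_of_all _ fun z => by positivity)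
    ((hg.int_sq hS).const_mul _) (hS.mono fun z hz => ?_)
  simp only [← mul_pow]
  exact pow_le_pow_left₀ (norm_nonneg _) (h z hz) 2

lemma N_add {f g : ℂ → ℂ} (hf : Nice f) (hg : Nice g) (hS : ∀ᵐ z ∂μ, ‖z‖ = 1) :
    N μ (fun z => f z + g z) ≤ N μ f + N μ g := by
  rw [N, Real.sqrt_le_left (add_nonneg (N_nonneg _) (N_nonneg _))]
  have h1 : ∫ z, ‖f z + g z‖ ^ 2 ∂μ ≤ ∫ z, (‖f z‖ ^ 2 + 2 * (‖f z‖ * ‖g z‖) + ‖g z‖ ^ 2) ∂μ := by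
    refine integral_mono ((hf.add hg).int_sq hS) (((hf.int_sq hS).add
      ((hf.int_norm_mul hg hS).const_mul 2)).add (hg.int_sq hS)) fun z => ?_
    have := norm_add_le (f z) (g z)
    have := pow_le_pow_left₀ (norm_nonneg _) this 2
    simp only
    linarith
  have hi : Integrable (fun z => ‖f z‖ ^ 2 + 2 * (‖f z‖ * ‖g z‖)) μ :=
    (hf.int_sq hS).add ((hf.int_norm_mul hg hS).const_mul 2)
  rw [integral_add hi (hg.int_sq hS), integral_add (hf.int_sq hS)
      ((hf.int_norm_mul hg hS).const_mul 2), integral_const_mul, ← N_sq f, ← N_sq g] at h1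
  have := N_cs hf hg hS
  nlinarith

lemma N_sub {f g : ℂ → ℂ} (hf : Nice f) (hg : Nice g) (hS : ∀ᵐ z ∂μ, ‖z‖ = 1) :
    N μ (fun z => f z - g z) ≤ N μ f + N μ g := by
  have h := N_add hf ((Nice.const (-1)).mul hg) hS
  have e : N μ (fun z => -1 * g z) = N μ g := by simp [N]
  rw [e] at h
  simpa [sub_eq_add_neg] using h

lemma N_congr {f g : ℂ → ℂ} (hS : ∀ᵐ z ∂μ, ‖z‖ = 1) (h : ∀ z, ‖z‖ = 1 → ‖f z‖ = ‖g z‖) :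
    N μ f = N μ g := by
  unfold N
  congr 1
  exact integral_congr_ae (hS.mono fun z hz => by simp [h z hz])

/-! star polynomials -/

lemma star_coeff {n : ℕ} {P : ℂ[X]} {k : ℕ} (hk : k ≤ n) :
    (starPoly n P).coeff k = conj (P.coeff (n - k)) := by
  simp [starPoly, coeff_reflect, revAt_le hk]

lemma star_coeff' {n : ℕ} {P : ℂ[X]} {k : ℕ} (hk : n < k) :
    (starPoly n P).coeff k = conj (P.coeff k) := by
  simp [starPoly, coeff_reflect, revAt_eq_self_of_lt hk]

lemma star_natDegree {n : ℕ} {P : ℂ[X]} (hP : P.natDegree ≤ n) :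
    (starPoly n P).natDegree ≤ n := by
  rw [natDegree_le_iff_coeff_eq_zero]
  intro k hk
  rw [star_coeff' hk, coeff_eq_zero_of_natDegree_lt (hP.trans_lt hk)]; simp

lemma circ_inv {z : ℂ} (hz : ‖z‖ = 1) : z * conj z = 1 := by
  rw [Complex.mul_conj, Complex.normSq_eq_norm_sq, hz]; simp

lemma circ_inv' {z : ℂ} (hz : ‖z‖ = 1) : conj z * z = 1 := by
  rw [mul_comm]; exact circ_inv hz

lemma star_eval {n : ℕ} {P : ℂ[X]} (hP : P.natDegree ≤ n) {z : ℂ} (hz : ‖z‖ = 1) :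
    (starPoly n P).eval z = z ^ n * conj (P.eval z) := by
  have hz0 : z ≠ 0 := by rintro rfl; simp at hz
  let _ : Invertible (conj z) := ⟨z, circ_inv hz, circ_inv' hz⟩
  have h := eval₂_reflect_mul_pow (RingHom.id ℂ) (conj z) n (P.map (starRingEnd ℂ))
    (natDegree_map_le.trans hP)
  have h2 : (starPoly n P).eval z * (conj z) ^ n = conj (P.eval z) := by
    rw [← eval_map_apply]
    exact h
  rw [← h2, mul_comm, mul_assoc, ← mul_pow, circ_inv' hz]; simp

lemma star_norm {n : ℕ} {P : ℂ[X]} (hP : P.natDegree ≤ n) {z : ℂ} (hz : ‖z‖ = 1) :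
    ‖(starPoly n P).eval z‖ = ‖P.eval z‖ := by
  rw [star_eval hP hz]; simp [hz]

lemma pstar_star {n : ℕ} {P : ℂ[X]} : starPoly n (starPoly n P) = P := by
  ext k
  rcases le_or_gt k n with h | h
  · rw [star_coeff h, star_coeff (Nat.sub_le _ _), Nat.sub_sub_self h]; simp
  · rw [star_coeff' h, star_coeff' h]; simp

lemma star_succ_X {n : ℕ} {P : ℂ[X]} (hP : P.natDegree ≤ n) :
    starPoly (n + 1) (X * P) = starPoly n P := by
  ext k
  rcases lt_trichotomy k (n + 1) with h | h | h
  · rw [star_coeff h.le, star_coeff (by omega), show n + 1 - k = (n - k) + 1 by omega, coeff_X_mul]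
  · rw [star_coeff h.le, star_coeff' (by omega), h]
    simp [coeff_eq_zero_of_natDegree_lt (Nat.lt_succ_of_le hP)]
  · rw [star_coeff' h, star_coeff' (by omega)]
    obtain ⟨j, rfl⟩ : ∃ j, k = j + 1 := ⟨k - 1, by omega⟩
    rw [coeff_X_mul, coeff_eq_zero_of_natDegree_lt (hP.trans_lt (by omega)),
      coeff_eq_zero_of_natDegree_lt (hP.trans_lt (by omega))]

lemma pstar_add {n : ℕ} {P Q : ℂ[X]} : starPoly n (P + Q) = starPoly n P + starPoly n Q := by
  simp [starPoly, reflect_add]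

lemma star_C_mul {n : ℕ} {P : ℂ[X]} {c : ℂ} :
    starPoly n (C c * P) = C (conj c) * starPoly n P := by
  simp [starPoly, reflect_C_mul]

lemma pstar_sub {n : ℕ} {P Q : ℂ[X]} : starPoly n (P - Q) = starPoly n P - starPoly n Q := by
  have : P - Q = P + C (-1) * Q := by simp [sub_eq_add_neg]
  rw [this, pstar_add, star_C_mul]; simp [sub_eq_add_neg]

/-- `z d/dz` -/
def DD (P : ℂ[X]) : ℂ[X] := X * derivative P

lemma DD_coeff (P : ℂ[X]) (k : ℕ) : (DD P).coeff k = k * P.coeff k := by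
  cases k with
  | zero => simp [DD]
  | succ k => rw [DD, coeff_X_mul, coeff_derivative]; push_cast; ring

lemma DD_star {n : ℕ} {P : ℂ[X]} (hP : P.natDegree ≤ n) :
    DD (starPoly n P) = - starPoly n (DD P - C (n : ℂ) * P) := by
  ext k
  rw [DD_coeff, coeff_neg]
  rcases le_or_gt k n with h | h
  · rw [star_coeff h, star_coeff h, coeff_sub, DD_coeff, coeff_C_mul]
    push_cast [Nat.cast_sub h]
    simp
    ring
  · rw [star_coeff' h, star_coeff' h, coeff_sub, DD_coeff, coeff_C_mul,
      coeff_eq_zero_of_natDegree_lt (hP.trans_lt h)]; simp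

lemma DD_natDegree {n : ℕ} {P : ℂ[X]} (hP : P.natDegree ≤ n) : (DD P).natDegree ≤ n := by
  rw [natDegree_le_iff_coeff_eq_zero]
  intro k hk
  rw [DD_coeff, coeff_eq_zero_of_natDegree_lt (hP.trans_lt hk)]; simp

lemma DD_sub_degree {n : ℕ} {P : ℂ[X]} (hP : P.natDegree ≤ n) :
    (DD P - C (n : ℂ) * P).degree < n := by
  rw [degree_lt_iff_coeff_zero]
  intro k hk
  rw [coeff_sub, DD_coeff, coeff_C_mul]
  rcases hk.eq_or_lt with h | h
  · rw [h]; ring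
  · rw [coeff_eq_zero_of_natDegree_lt (hP.trans_lt h)]; simp

/-! expansion -/

lemma expand {φ : ℕ → ℂ[X]} (hd : ∀ n, (φ n).degree = n) (n : ℕ) :
    ∀ P : ℂ[X], P.degree < n → ∃ c : ℕ → ℂ, P = ∑ k ∈ Finset.range n, C (c k) * φ k := by
  induction n with
  | zero =>
    intro P hP
    refine ⟨0, ?_⟩
    simpa using hP
  | succ n ih =>
    intro P hP
    have hl : (φ n).coeff n ≠ 0 := coeff_ne_zero_of_eq_degree (hd n)
    have h : (P - C (P.coeff n / (φ n).coeff n) * φ n).degree < n := by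
      rw [degree_lt_iff_coeff_zero]
      intro k hk
      rw [coeff_sub, coeff_C_mul]
      rcases hk.eq_or_lt with h | h
      · rw [← h]; field_simp; ring
      · rw [degree_lt_iff_coeff_zero] at hP
        rw [hP k (by exact_mod_cast h), coeff_eq_zero_of_degree_lt (p := φ n) (n := k) (by rw [hd]; exact_mod_cast h)]
        simp
    obtain ⟨c, hc⟩ := ih _ h
    refine ⟨fun k => if k = n then P.coeff n / (φ n).coeff n else c k, ?_⟩
    rw [Finset.sum_range_succ]
    simp only [if_true]
    rw [← sub_eq_iff_eq_add, hc]
    refine Finset.sum_congr rfl fun k hk => ?_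
    simp only [if_neg (show ¬ k = n by simp at hk; omega)]

/-- weighted inner product -/
def wip (μ : Measure ℂ) (w : ℂ → ℂ) (P Q : ℂ[X]) : ℂ :=
  ∫ z, w z * (conj (P.eval z) * Q.eval z) ∂μ

section wip
variable {w : ℂ → ℂ} (hw : Nice w) (hS : ∀ᵐ z ∂μ, ‖z‖ = 1)
include hw hS

lemma wip_int (P Q : ℂ[X]) : Integrable (fun z => w z * (conj (P.eval z) * Q.eval z)) μ :=
  (hw.mul ((Nice.poly P).conj.mul (Nice.poly Q))).int hS

lemma wip_add_right (P Q R : ℂ[X]) : wip μ w P (Q + R) = wip μ w P Q + wip μ w P R := by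
  unfold wip
  rw [← integral_add (wip_int hw hS _ _) (wip_int hw hS _ _)]
  congr 1; ext z; rw [eval_add]; ring

lemma wip_sub_right (P Q R : ℂ[X]) : wip μ w P (Q - R) = wip μ w P Q - wip μ w P R := by
  unfold wip
  rw [← integral_sub (wip_int hw hS _ _) (wip_int hw hS _ _)]
  congr 1; ext z; rw [eval_sub]; ring

lemma wip_add_left (P Q R : ℂ[X]) : wip μ w (P + Q) R = wip μ w P R + wip μ w Q R := by
  unfold wip
  rw [← integral_add (wip_int hw hS _ _) (wip_int hw hS _ _)]
  congr 1; ext z; rw [eval_add, map_add]; ring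

omit [IsProbabilityMeasure μ] hw hS in
lemma wip_C_right (P Q : ℂ[X]) (c : ℂ) : wip μ w P (C c * Q) = c * wip μ w P Q := by
  unfold wip
  rw [← integral_const_mul]
  congr 1; ext z; rw [eval_mul, eval_C]; ring

omit [IsProbabilityMeasure μ] hw hS in
lemma wip_C_left (P Q : ℂ[X]) (c : ℂ) : wip μ w (C c * P) Q = conj c * wip μ w P Q := by
  unfold wip
  rw [← integral_const_mul]
  congr 1; ext z; rw [eval_mul, eval_C, map_mul]; ring

lemma wip_sum_right {ι : Type*} (s : Finset ι) (P : ℂ[X]) (Q : ι → ℂ[X]) :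
    wip μ w P (∑ i ∈ s, Q i) = ∑ i ∈ s, wip μ w P (Q i) := by
  classical
  induction s using Finset.induction_on with
  | empty => simp [wip]
  | insert a s ha ih => rw [Finset.sum_insert ha, Finset.sum_insert ha, wip_add_right hw hS, ih]

lemma wip_sum_left {ι : Type*} (s : Finset ι) (P : ℂ[X]) (Q : ι → ℂ[X]) :
    wip μ w (∑ i ∈ s, Q i) P = ∑ i ∈ s, wip μ w (Q i) P := by
  classical
  induction s using Finset.induction_on with
  | empty => simp [wip]
  | insert a s ha ih => rw [Finset.sum_insert ha, Finset.sum_insert ha, wip_add_left hw hS, ih]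

end wip

lemma nice_one : Nice 1 := Nice.of_cont continuous_const

lemma ip_conj (P Q : ℂ[X]) : conj (wip μ 1 P Q) = wip μ 1 Q P := by
  unfold wip
  rw [← integral_conj]
  congr 1; ext z; simp; ring

lemma ip_X (hS : ∀ᵐ z ∂μ, ‖z‖ = 1) (P Q : ℂ[X]) : wip μ 1 (X * P) (X * Q) = wip μ 1 P Q := by
  unfold wip
  refine integral_congr_ae (hS.mono fun z hz => ?_)
  simp only [eval_mul, eval_X, map_mul]
  linear_combination (1 : ℂ → ℂ) z * conj (P.eval z) * Q.eval z * circ_inv hz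

lemma ip_star (hS : ∀ᵐ z ∂μ, ‖z‖ = 1) {n : ℕ} {P Q : ℂ[X]} (hP : P.natDegree ≤ n)
    (hQ : Q.natDegree ≤ n) : wip μ 1 P (starPoly n Q) = wip μ 1 Q (starPoly n P) := by
  unfold wip
  refine integral_congr_ae (hS.mono fun z hz => ?_)
  simp only [star_eval hP hz, star_eval hQ hz]
  ring

lemma star_lower {n : ℕ} {P : ℂ[X]} (hP : P.natDegree ≤ n) :
    starPoly (n + 1) P = X * starPoly n P := by
  have h := star_succ_X (star_natDegree hP)
  rw [pstar_star] at h
  rw [← pstar_star (n := n + 1) (P := X * starPoly n P), h]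

/-- weighted orthonormal polynomials -/
structure WOP (μ : Measure ℂ) (w : ℂ → ℂ) (φ : ℕ → ℂ[X]) : Prop where
  deg : ∀ n, (φ n).degree = n
  orth : ∀ m n, wip μ w (φ m) (φ n) = if m = n then 1 else 0

section WOP
variable {w : ℂ → ℂ} {φ : ℕ → ℂ[X]} (hφ : WOP μ w φ) (hw : Nice w) (hS : ∀ᵐ z ∂μ, ‖z‖ = 1)
include hφ

omit [IsProbabilityMeasure μ] in
lemma WOP.natDeg (n : ℕ) : (φ n).natDegree = n := natDegree_eq_of_degree_eq_some (hφ.deg n)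

include hw hS

lemma WOP.low {n : ℕ} {P : ℂ[X]} (hP : P.degree < n) : wip μ w P (φ n) = 0 := by
  obtain ⟨c, rfl⟩ := expand hφ.deg n P hP
  rw [wip_sum_left hw hS]
  refine Finset.sum_eq_zero fun k hk => ?_
  rw [wip_C_left, hφ.orth, if_neg (by simp at hk; omega), mul_zero]

lemma WOP.low' {n : ℕ} {P : ℂ[X]} (hP : P.degree < n) : wip μ w (φ n) P = 0 := by
  obtain ⟨c, rfl⟩ := expand hφ.deg n P hP
  rw [wip_sum_right hw hS]
  refine Finset.sum_eq_zero fun k hk => ?_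
  rw [wip_C_right, hφ.orth, if_neg (by simp at hk; omega), mul_zero]

lemma WOP.repr {n : ℕ} {P : ℂ[X]} (hP : P.degree < n) :
    P = ∑ k ∈ Finset.range n, C (wip μ w (φ k) P) * φ k := by
  obtain ⟨c, hc⟩ := expand hφ.deg n P hP
  have : ∀ k ∈ Finset.range n, wip μ w (φ k) P = c k := by
    intro k hk
    rw [hc, wip_sum_right hw hS, Finset.sum_eq_single k]
    · rw [wip_C_right, hφ.orth, if_pos rfl, mul_one]
    · intro j _ hj
      rw [wip_C_right, hφ.orth, if_neg (Ne.symm hj), mul_zero]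
    · exact fun h => absurd hk h
  rw [Finset.sum_congr rfl fun k hk => by rw [this k hk]]
  exact hc

end WOP

/-- data of the Szegő recursion -/
structure Szego (φ : ℕ → ℂ[X]) (ρ : ℕ → ℝ) (α : ℕ → ℂ) : Prop where
  pos : ∀ n, 0 < ρ n
  sq : ∀ n, ρ n ^ 2 + ‖α n‖ ^ 2 = 1
  rec1 : ∀ n, C (ρ n : ℂ) * φ (n + 1) = X * φ n - C (conj (α n)) * starPoly n (φ n)
  rec2 : ∀ n, C (ρ n : ℂ) * starPoly (n + 1) (φ (n + 1)) = starPoly n (φ n) - C (α n) * (X * φ n)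
  zero : starPoly 0 (φ 0) = φ 0

lemma star_low (hS : ∀ᵐ z ∂μ, ‖z‖ = 1) {φ : ℕ → ℂ[X]} (hφ : WOP μ 1 φ) {n : ℕ} {T : ℂ[X]}
    (hT : (X * T).natDegree ≤ n) : wip μ 1 (starPoly n (φ n)) (X * T) = 0 := by
  cases n with
  | zero =>
    have : T = 0 := by
      by_contra h
      rw [natDegree_X_mul h] at hT
      omega
    simp [this, wip]
  | succ n =>
    have hT' : T.natDegree ≤ n := by
      by_cases h : T = 0
      · simp [h]
      · rw [natDegree_X_mul h] at hT
        omega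
    have h1 : X * T = starPoly (n + 1) (starPoly n T) := by
      rw [star_lower (star_natDegree hT'), pstar_star]
    rw [h1, ip_star hS (star_natDegree (hφ.natDeg _).le) ((star_natDegree hT').trans (by omega)),
      pstar_star]
    refine hφ.low nice_one hS ?_
    refine (degree_le_of_natDegree_le (star_natDegree hT')).trans_lt ?_
    exact_mod_cast Nat.lt_succ_self n

lemma szego (hS : ∀ᵐ z ∂μ, ‖z‖ = 1) {φ : ℕ → ℂ[X]} (hφ : IsOPUC μ φ) :
    ∃ ρ, Szego φ ρ (verblunsky φ) := by
  have hW : WOP μ 1 φ := ⟨hφ.deg, fun m n => by rw [← hφ.orth m n]; simp [wip]⟩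
  have hκ : ∀ n, (((φ n).coeff n).re : ℂ) = (φ n).coeff n ∧ 0 < ((φ n).coeff n).re := by
    intro n
    have h1 := hφ.lead_re_pos n
    have h2 := hφ.lead_im_zero n
    rw [leadingCoeff, hW.natDeg] at h1 h2
    exact ⟨Complex.ext (by simp) (by simp [h2]), h1⟩
  set κ : ℕ → ℝ := fun n => ((φ n).coeff n).re with hκd
  have hκ1 : ∀ n, (φ n).coeff n = κ n := fun n => ((hκ n).1).symm
  have hκ0 : ∀ n, 0 < κ n := fun n => (hκ n).2
  have hκC : ∀ n, (κ n : ℂ) ≠ 0 := fun n => by exact_mod_cast (hκ0 n).ne'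
  have hdX : ∀ n, (X * φ n).natDegree ≤ n + 1 := fun n => by
    rw [natDegree_X_mul (by intro h; have := hφ.deg n; simp [h] at this), hW.natDeg]
  have r1 : ∀ n, C ((κ n / κ (n + 1) : ℝ) : ℂ) * φ (n + 1)
      = X * φ n - C (conj (verblunsky φ n)) * starPoly n (φ n) := by
    intro n
    set ρ : ℂ := ((κ n / κ (n + 1) : ℝ) : ℂ) with hρ
    have hρ' : ρ * κ (n + 1) = κ n := by
      rw [hρ]; push_cast; field_simp [hκC (n + 1)]
    set Q := C ρ * φ (n + 1) - X * φ n with hQ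
    have hQd : Q.natDegree ≤ n := by
      rw [natDegree_le_iff_coeff_eq_zero]
      intro k hk
      rw [hQ, coeff_sub, coeff_C_mul]
      obtain ⟨j, rfl⟩ : ∃ j, k = j + 1 := ⟨k - 1, by omega⟩
      rw [coeff_X_mul]
      rcases (show n ≤ j by omega).eq_or_lt with h | h
      · subst h; rw [hκ1, hκ1, hρ', sub_self]
      · rw [coeff_eq_zero_of_natDegree_lt (by rw [hW.natDeg]; omega),
          coeff_eq_zero_of_natDegree_lt (by rw [hW.natDeg]; omega)]; simp
    have hSd : (starPoly n Q).degree < (n + 1 : ℕ) :=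
      (degree_le_of_natDegree_le (star_natDegree hQd)).trans_lt (by exact_mod_cast n.lt_succ_self)
    have hrep := hW.repr nice_one hS hSd
    rw [Finset.sum_range_succ, Finset.sum_eq_zero, zero_add] at hrep
    · set c := wip μ 1 (φ n) (starPoly n Q) with hc
      have hQ2 : Q = C (conj c) * starPoly n (φ n) := by
        rw [← star_C_mul, ← hrep, pstar_star]
      have h0 : ρ * (φ (n + 1)).coeff 0 = conj c * κ n := by
        have := congrArg (fun P => coeff P 0) hQ2
        simp only [hQ, coeff_sub, coeff_C_mul, coeff_X_mul_zero, sub_zero,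
          star_coeff (Nat.zero_le n), Nat.sub_zero, hκ1] at this
        rw [this, Complex.conj_ofReal]
      have hv : conj (verblunsky φ n) = - conj c := by
        simp only [verblunsky, monicOP, leadingCoeff, hW.natDeg, hκ1]
        rw [map_neg, Complex.conj_conj, eval_mul, eval_C, ← coeff_zero_eq_eval_zero]
        congr 1
        have : ρ ≠ 0 := by
          intro h
          rw [h, zero_mul] at hρ'
          exact hκC n hρ'.symm
        rw [← hρ', ← mul_assoc, mul_comm (conj c), mul_assoc] at h0
        have := mul_left_cancel₀ this h0
        rw [this]; field_simp [hκC (n + 1)]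
      rw [hv, map_neg, neg_mul, sub_neg_eq_add, ← hQ2, hQ]; ring
    · intro k hk
      have hk : k < n := by simpa using hk
      obtain ⟨m, rfl⟩ : ∃ m, n = m + 1 := ⟨n - 1, by omega⟩
      have hkm : (φ k).natDegree ≤ m := by rw [hW.natDeg]; omega
      have hstar : (starPoly m (φ k)).degree < ((m + 1 : ℕ) : WithBot ℕ) :=
        (degree_le_of_natDegree_le (star_natDegree hkm)).trans_lt
          (by exact_mod_cast m.lt_succ_self)
      rw [ip_star hS (by rw [hW.natDeg]; omega) hQd, star_lower hkm, ← ip_conj, hQ,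
        wip_sub_right nice_one hS, wip_C_right, ip_X hS, hW.low nice_one hS hstar,
        hW.low nice_one hS]
      · simp
      · refine lt_of_le_of_lt (degree_le_of_natDegree_le (natDegree_mul_le)) ?_
        have := star_natDegree hkm
        rw [natDegree_X]
        exact_mod_cast (by omega)
  have r2 : ∀ n, C ((κ n / κ (n + 1) : ℝ) : ℂ) * starPoly (n + 1) (φ (n + 1))
      = starPoly n (φ n) - C (verblunsky φ n) * (X * φ n) := by
    intro n
    have := congrArg (starPoly (n + 1)) (r1 n)
    rw [pstar_sub, star_C_mul, star_C_mul, star_succ_X (hW.natDeg n).le,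
      star_lower (star_natDegree (hW.natDeg n).le), pstar_star, Complex.conj_conj,
      Complex.conj_ofReal] at this
    exact this
  refine ⟨fun n => κ n / κ (n + 1), fun n => div_pos (hκ0 _) (hκ0 _), fun n => ?_, r1, r2, ?_⟩
  · have h1 : wip μ 1 (X * φ n) (X * φ n) = 1 := by rw [ip_X hS, hW.orth, if_pos rfl]
    have h2 : X * φ n = C ((κ n / κ (n + 1) : ℝ) : ℂ) * φ (n + 1)
      + C (conj (verblunsky φ n)) * starPoly n (φ n) := by rw [r1 n]; ring
    have hd : (starPoly n (φ n)).degree < (n + 1 : ℕ) :=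
      (degree_le_of_natDegree_le (star_natDegree (hW.natDeg n).le)).trans_lt
        (by exact_mod_cast n.lt_succ_self)
    rw [h2, wip_add_right nice_one hS, wip_add_left nice_one hS, wip_add_left nice_one hS] at h1
    simp only [wip_C_left, wip_C_right, hW.low nice_one hS hd, hW.low' nice_one hS hd,
      ip_star hS (star_natDegree (hW.natDeg n).le) (hW.natDeg n).le, pstar_star, hW.orth,
      if_true] at h1
    have h3 : (((κ n / κ (n + 1)) ^ 2 + ‖verblunsky φ n‖ ^ 2 : ℝ) : ℂ) = 1 := by
      rw [← h1, Complex.ofReal_add, Complex.ofReal_pow, Complex.ofReal_pow,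
        ← Complex.conj_mul', Complex.conj_ofReal, Complex.conj_conj]
      ring
    exact_mod_cast h3
  · ext k
    cases k with
    | zero => rw [star_coeff le_rfl, hκ1, Complex.conj_ofReal]
    | succ k => rw [star_coeff' (by omega), coeff_eq_zero_of_natDegree_lt
        (by rw [hW.natDeg]; omega)]; simp

end OPH
namespace OPH

lemma cd {φ : ℕ → ℂ[X]} {ρ α} (h : Szego φ ρ α) (n : ℕ) (w : ℂ) :
    (1 - C (conj w) * X) * ∑ k ∈ Finset.range n, C (conj ((φ k).eval w)) * φ k =
      C (conj ((starPoly n (φ n)).eval w)) * starPoly n (φ n) - C (conj ((φ n).eval w)) * φ n := by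
  induction n with
  | zero => simp [h.zero]
  | succ n ih =>
    rw [Finset.sum_range_succ, mul_add, ih]
    have hρ : C ((ρ n : ℂ) ^ 2) ≠ 0 := by
      rw [Ne, C_eq_zero]
      exact_mod_cast (pow_pos (h.pos n) 2).ne'
    apply mul_left_cancel₀ hρ
    have e1 := congrArg (fun P => conj (eval w P)) (h.rec1 n)
    have e2 := congrArg (fun P => conj (eval w P)) (h.rec2 n)
    simp only [eval_mul, eval_sub, eval_C, eval_X, map_mul, map_sub, Complex.conj_conj,
      Complex.conj_ofReal] at e1 e2
    have e3 : C ((ρ n : ℂ) ^ 2) * (C (conj ((starPoly (n+1) (φ (n+1))).eval w))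
        * starPoly (n+1) (φ (n+1)) - C (conj ((φ (n+1)).eval w)) * φ (n+1)) =
        C ((ρ n : ℂ) * conj ((starPoly (n+1) (φ (n+1))).eval w)) *
          (C (ρ n : ℂ) * starPoly (n+1) (φ (n+1))) -
        C ((ρ n : ℂ) * conj ((φ (n+1)).eval w)) * (C (ρ n : ℂ) * φ (n+1)) := by
      simp only [map_mul, map_pow]; ring
    have e4 : ((ρ n : ℂ)) ^ 2 = 1 - α n * conj (α n) := by
      have := h.sq n
      rw [Complex.mul_conj', eq_sub_iff_add_eq]
      exact_mod_cast this
    rw [e3, h.rec1, h.rec2, e1, e2, e4]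
    simp only [map_mul, map_sub, map_one]
    ring

variable {μ : Measure ℂ} [IsProbabilityMeasure μ]

section nevai
variable (hS : ∀ᵐ z ∂μ, ‖z‖ = 1) {φ : ℕ → ℂ[X]} (hW : WOP μ 1 φ) {ρ : ℕ → ℝ} {α : ℕ → ℂ}
  (hz : Szego φ ρ α) (hα : Tendsto α atTop (𝓝 0))

/-- norm of a polynomial -/
def NP (μ : Measure ℂ) (P : ℂ[X]) : ℝ := N μ (fun z => P.eval z)

lemma NP_sq (P : ℂ[X]) : ((NP μ P ^ 2 : ℝ) : ℂ) = wip μ 1 P P := by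
  rw [NP, N_sq, ← integral_complex_ofReal, wip]
  congr 1; ext z
  simp [Complex.conj_mul']

lemma NP_nonneg (P : ℂ[X]) : 0 ≤ NP μ P := N_nonneg _

include hW in
lemma NP_phi (n : ℕ) : NP μ (φ n) = 1 := by
  have h := NP_sq (μ := μ) (φ n)
  rw [hW.orth, if_pos rfl] at h
  have h : NP μ (φ n) ^ 2 = 1 := by exact_mod_cast h
  exact (pow_eq_one_iff_of_nonneg (NP_nonneg _) (by norm_num)).1 h

include hS

lemma NP_star {n : ℕ} {P : ℂ[X]} (hP : P.natDegree ≤ n) : NP μ (starPoly n P) = NP μ P :=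
  N_congr hS fun _ hz => star_norm hP hz

lemma NP_X (P : ℂ[X]) : NP μ (X * P) = NP μ P :=
  N_congr hS fun z hz => by simp [hz]

lemma NP_Xpow (k : ℕ) (P : ℂ[X]) : NP μ (X ^ k * P) = NP μ P :=
  N_congr hS fun z hz => by simp [hz]

lemma NP_C (c : ℂ) (P : ℂ[X]) : NP μ (C c * P) ≤ ‖c‖ * NP μ P :=
  N_mono (Nice.poly P) hS (norm_nonneg _) fun z _ => by simp

lemma NP_add (P Q : ℂ[X]) : NP μ (P + Q) ≤ NP μ P + NP μ Q := by
  have := N_add (Nice.poly P) (Nice.poly Q) hS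
  simpa [NP] using this

lemma NP_sub (P Q : ℂ[X]) : NP μ (P - Q) ≤ NP μ P + NP μ Q := by
  have := N_sub (Nice.poly P) (Nice.poly Q) hS
  simpa [NP] using this

lemma ip_le (P Q : ℂ[X]) : ‖wip μ 1 P Q‖ ≤ NP μ P * NP μ Q := by
  have := N_cs' (Nice.poly P).conj (Nice.poly Q) hS
  have e : N μ (fun z => conj (P.eval z)) = NP μ P := N_congr hS fun z _ => by simp
  rw [e] at this
  simpa [wip, NP] using this

include hW in
lemma NP_fs (n : ℕ) : NP μ (starPoly n (φ n)) = 1 := by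
  rw [NP_star hS (hW.natDeg n).le, NP_phi hW]

omit hS in
include hz in
lemma rho_bd (n : ℕ) : ‖(1 - ρ n : ℂ)‖ ≤ ‖α n‖ := by
  have h1 := hz.pos n
  have h2 := hz.sq n
  have h3 := norm_nonneg (α n)
  have h4 : ρ n ≤ 1 := by nlinarith
  have h5 : ‖α n‖ ≤ 1 := by nlinarith
  have : (1 - ρ n : ℂ) = ((1 - ρ n : ℝ) : ℂ) := by push_cast; rfl
  rw [this, Complex.norm_real, Real.norm_eq_abs, abs_of_nonneg (by linarith)]
  nlinarith

include hW hz

lemma step1 (n : ℕ) : NP μ (φ (n + 1) - X * φ n) ≤ 2 * ‖α n‖ := by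
  have e : φ (n + 1) - X * φ n
      = C (1 - ρ n : ℂ) * φ (n + 1) - C (conj (α n)) * starPoly n (φ n) := by
    have := hz.rec1 n
    rw [C_sub, sub_mul, this, C_1]; ring
  rw [e]
  refine (NP_sub hS _ _).trans ?_
  have h1 := NP_C (μ := μ) hS (1 - ρ n : ℂ) (φ (n + 1))
  have h2 := NP_C (μ := μ) hS (conj (α n)) (starPoly n (φ n))
  rw [NP_phi hW] at h1
  rw [NP_fs hS hW, RCLike.norm_conj] at h2
  have := rho_bd hz n
  linarith

lemma step2 (n : ℕ) : NP μ (starPoly (n + 1) (φ (n + 1)) - starPoly n (φ n)) ≤ 2 * ‖α n‖ := by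
  have e : starPoly (n + 1) (φ (n + 1)) - starPoly n (φ n)
      = C (1 - ρ n : ℂ) * starPoly (n + 1) (φ (n + 1)) - C (α n) * (X * φ n) := by
    have := hz.rec2 n
    rw [C_sub, sub_mul, this, C_1]; ring
  rw [e]
  refine (NP_sub hS _ _).trans ?_
  have h1 := NP_C (μ := μ) hS (1 - ρ n : ℂ) (starPoly (n + 1) (φ (n + 1)))
  have h2 := NP_C (μ := μ) hS (α n) (X * φ n)
  rw [NP_fs hS hW] at h1
  rw [NP_X hS, NP_phi hW] at h2
  have := rho_bd hz n
  linarith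

include hα

lemma lim1 (k : ℕ) : Tendsto (fun n => NP μ (φ (n + k) - X ^ k * φ n)) atTop (𝓝 0) := by
  induction k with
  | zero => simp [NP, N]
  | succ k ih =>
    have h1 : Tendsto (fun n => 2 * ‖α (n + k)‖) atTop (𝓝 0) := by
      have := ((tendsto_add_atTop_iff_nat k).2 hα).norm.const_mul 2
      simpa using this
    refine squeeze_zero (fun n => NP_nonneg _) (fun n => ?_) (by simpa using h1.add ih)
    have e : φ (n + (k + 1)) - X ^ (k + 1) * φ n
      = (φ (n + k + 1) - X * φ (n + k)) + X * (φ (n + k) - X ^ k * φ n) := by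
      rw [← add_assoc]; ring
    rw [e]
    refine (NP_add hS _ _).trans ?_
    rw [NP_X hS]
    have := step1 hS hW hz (n + k)
    linarith

lemma lim2 (k : ℕ) : Tendsto (fun n => NP μ (starPoly (n + k) (φ (n + k)) - starPoly n (φ n)))
    atTop (𝓝 0) := by
  induction k with
  | zero => simp [NP, N]
  | succ k ih =>
    have h1 : Tendsto (fun n => 2 * ‖α (n + k)‖) atTop (𝓝 0) := by
      have := ((tendsto_add_atTop_iff_nat k).2 hα).norm.const_mul 2
      simpa using this
    refine squeeze_zero (fun n => NP_nonneg _) (fun n => ?_) (by simpa using h1.add ih)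
    have e : starPoly (n + (k + 1)) (φ (n + (k + 1))) - starPoly n (φ n)
      = (starPoly (n + k + 1) (φ (n + k + 1)) - starPoly (n + k) (φ (n + k))) +
        (starPoly (n + k) (φ (n + k)) - starPoly n (φ n)) := by
      rw [← add_assoc]; ring
    rw [e]
    refine (NP_add hS _ _).trans ?_
    have := step2 hS hW hz (n + k)
    linarith

lemma mom1 (k : ℕ) (hk : 1 ≤ k) :
    Tendsto (fun n => wip μ 1 (φ n) (X ^ k * φ n)) atTop (𝓝 0) := by
  refine squeeze_zero_norm (fun n => ?_) (lim1 hS hW hz hα k)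
  have e : X ^ k * φ n = φ (n + k) - (φ (n + k) - X ^ k * φ n) := by ring
  rw [e, wip_sub_right nice_one hS, hW.orth, if_neg (by omega), zero_sub, norm_neg]
  refine (ip_le hS _ _).trans ?_
  rw [NP_phi hW, one_mul]
  rw [← e]

lemma mom2 (k : ℕ) : Tendsto (fun n => wip μ 1 (φ n) (X ^ k * starPoly n (φ n))) atTop (𝓝 0) := by
  rw [← tendsto_add_atTop_iff_nat (k + 1)]
  refine squeeze_zero_norm (fun n => ?_) (lim2 hS hW hz hα (k + 1))
  have e : X ^ k * starPoly (n + (k + 1)) (φ (n + (k + 1))) = X ^ k * starPoly n (φ n) +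
    X ^ k * (starPoly (n + (k + 1)) (φ (n + (k + 1))) - starPoly n (φ n)) := by ring
  rw [e, wip_add_right nice_one hS, hW.low' nice_one hS, zero_add]
  · refine (ip_le hS _ _).trans ?_
    rw [NP_phi hW, one_mul, NP_Xpow hS]
  · refine lt_of_le_of_lt (degree_le_of_natDegree_le natDegree_mul_le) ?_
    have := star_natDegree (hW.natDeg n).le
    rw [natDegree_X_pow]
    exact_mod_cast (by omega)

lemma mom3 (k : ℕ) (hk : 1 ≤ k) :
    Tendsto (fun n => wip μ 1 (X ^ k * φ n) (starPoly n (φ n))) atTop (𝓝 0) := by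
  refine squeeze_zero_norm (fun n => ?_) (lim2 hS hW hz hα k)
  obtain ⟨j, rfl⟩ : ∃ j, k = j + 1 := ⟨k - 1, by omega⟩
  have h0 : wip μ 1 (X ^ (j + 1) * φ n) (starPoly (n + (j + 1)) (φ (n + (j + 1)))) = 0 := by
    rw [← ip_conj, pow_succ', mul_assoc, star_low hS hW, map_zero]
    refine natDegree_mul_le.trans ?_
    have h1 := natDegree_mul_le (p := (X : ℂ[X]) ^ j) (q := φ n)
    rw [natDegree_X_pow, hW.natDeg] at h1
    rw [natDegree_X]; omega
  have e : starPoly n (φ n) = starPoly (n + (j + 1)) (φ (n + (j + 1))) -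
    (starPoly (n + (j + 1)) (φ (n + (j + 1))) - starPoly n (φ n)) := by ring
  rw [e, wip_sub_right nice_one hS, h0, zero_sub, norm_neg]
  refine (ip_le hS _ _).trans ?_
  rw [NP_Xpow hS, NP_phi hW, one_mul, ← e]

end nevai

/-- the off-diagonal functional -/
def Lam (μ : Measure ℂ) (φ : ℕ → ℂ[X]) (n : ℕ) (h : ℂ → ℂ) : ℂ :=
  ∫ z, h z * (conj ((φ n).eval z) * (starPoly n (φ n)).eval z) ∂μ

section lam
variable (hS : ∀ᵐ z ∂μ, ‖z‖ = 1) {φ : ℕ → ℂ[X]} (hW : WOP μ 1 φ) {ρ : ℕ → ℝ} {α : ℕ → ℂ}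
  (hz : Szego φ ρ α) (hα : Tendsto α atTop (𝓝 0))
include hS

lemma Lam_add (n : ℕ) {f g : ℂ → ℂ} (hf : Nice f) (hg : Nice g) :
    Lam μ φ n (fun z => f z + g z) = Lam μ φ n f + Lam μ φ n g := by
  unfold Lam
  rw [← integral_add (wip_int hf hS _ _) (wip_int hg hS _ _)]
  congr 1; ext z; ring

lemma Lam_sub (n : ℕ) {f g : ℂ → ℂ} (hf : Nice f) (hg : Nice g) :
    Lam μ φ n (fun z => f z - g z) = Lam μ φ n f - Lam μ φ n g := by
  unfold Lam
  rw [← integral_sub (wip_int hf hS _ _) (wip_int hg hS _ _)]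
  congr 1; ext z; ring

omit [IsProbabilityMeasure μ] hS in
lemma Lam_const (n : ℕ) (c : ℂ) (f : ℂ → ℂ) :
    Lam μ φ n (fun z => c * f z) = c * Lam μ φ n f := by
  unfold Lam
  rw [← integral_const_mul]
  congr 1; ext z; ring

include hW

lemma Lam_bd (n : ℕ) {f : ℂ → ℂ} {C : ℝ} (h : ∀ z, ‖z‖ = 1 → ‖f z‖ ≤ C) :
    ‖Lam μ φ n f‖ ≤ C := by
  refine (norm_integral_le_integral_norm _).trans ?_
  have h1 : ∫ z, C * ‖(φ n).eval z‖ ^ 2 ∂μ = C := by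
    rw [integral_const_mul, ← N_sq]
    have := NP_phi hW n
    rw [NP] at this
    rw [this]; simp
  rw [← h1]
  refine integral_mono_of_nonneg (ae_of_all _ fun z => norm_nonneg _)
    (((Nice.poly (φ n)).int_sq hS).const_mul _) (hS.mono fun z hz => ?_)
  simp only [norm_mul, RCLike.norm_conj, star_norm (hW.natDeg n).le hz, ← sq]
  exact mul_le_mul_of_nonneg_right (h z hz) (by positivity)

include hz hα

lemma Lam_zpow (k : ℤ) : Tendsto (fun n => Lam μ φ n (fun z => z ^ k)) atTop (𝓝 0) := by
  rcases k with k | k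
  · refine (mom2 hS hW hz hα k).congr fun n => ?_
    unfold wip Lam
    congr 1; ext z; simp; ring
  · refine (mom3 hS hW hz hα (k + 1) (by omega)).congr fun n => ?_
    unfold wip Lam
    refine integral_congr_ae (hS.mono fun z hz => ?_)
    simp only [zpow_negSucc, eval_mul, eval_pow, eval_X, map_mul, map_pow, Pi.one_apply]
    rw [← inv_pow, inv_eq_of_mul_eq_one_right (circ_inv hz)]; ring

lemma Lam_cont {h : ℂ → ℂ} (hh : Continuous h) :
    Tendsto (fun n => Lam μ φ n h) atTop (𝓝 0) := by
  have : Fact (0 < 2 * Real.pi) := ⟨Real.two_pi_pos⟩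
  have hfour : ∀ (k : ℤ) (z : ℂ), ‖z‖ = 1 →
      fourier k ((Complex.arg z : ℝ) : AddCircle (2 * Real.pi)) = z ^ k := by
    intro k z hz
    have h1 : Complex.exp (Complex.arg z * Complex.I) = z := by
      have := Complex.norm_mul_exp_arg_mul_I z
      rw [hz] at this; simpa using this
    conv_rhs => rw [← h1, ← Complex.exp_int_mul]
    rw [fourier_coe_apply]
    congr 1
    push_cast
    have : (Real.pi : ℂ) ≠ 0 := by exact_mod_cast Real.pi_ne_zero
    field_simp
  have hnice : ∀ p : C(AddCircle (2 * Real.pi), ℂ), Nice (fun z => p (Complex.arg z : ℝ)) := by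
    intro p
    refine ⟨(p.continuous.comp (AddCircle.continuous_mk' _)).measurable.comp
      Complex.measurable_arg, ‖p‖, fun z _ => p.norm_coe_le_norm _⟩
  have hspan : ∀ p ∈ Submodule.span ℂ (Set.range (@fourier (2 * Real.pi))),
      Tendsto (fun n => Lam μ φ n (fun z => p (Complex.arg z : ℝ))) atTop (𝓝 0) := by
    intro p hp
    induction hp using Submodule.span_induction with
    | mem p hp =>
      obtain ⟨k, rfl⟩ := hp
      refine (Lam_zpow hS hW hz hα k).congr fun n => ?_
      unfold Lam
      exact integral_congr_ae (hS.mono fun z hz => by simp only [hfour k z hz])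
    | zero => simp [Lam]
    | add p q _ _ h1 h2 =>
      have := h1.add h2
      rw [add_zero] at this
      refine this.congr fun n => ?_
      rw [← Lam_add hS n (hnice p) (hnice q)]; rfl
    | smul c p _ h1 =>
      have := h1.const_mul c
      rw [mul_zero] at this
      refine this.congr fun n => ?_
      rw [← Lam_const]; rfl
  let f : C(AddCircle (2 * Real.pi), ℂ) :=
    ⟨fun θ => h (fourier 1 θ), hh.comp (ContinuousMap.continuous _)⟩
  rw [Metric.tendsto_atTop]
  intro ε hε
  have hf : f ∈ (Submodule.span ℂ (Set.range (@fourier (2 * Real.pi)))).topologicalClosure := by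
    rw [span_fourier_closure_eq_top]; trivial
  obtain ⟨p, hp, hpf⟩ := Metric.mem_closure_iff.1 hf (ε / 2) (by positivity)
  obtain ⟨n0, hn0⟩ := Metric.tendsto_atTop.1 (hspan p hp) (ε / 2) (by positivity)
  refine ⟨n0, fun n hn => ?_⟩
  have h1 := hn0 n hn
  rw [dist_zero_right] at h1 ⊢
  have h2 := Lam_sub hS (φ := φ) n (Nice.of_cont hh) (hnice p)
  have h3 : ‖Lam μ φ n (fun z => h z - p (Complex.arg z : ℝ))‖ ≤ ε / 2 := by
    refine Lam_bd hS hW n fun z hz => ?_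
    have : h z = f (Complex.arg z : ℝ) := by
      simp only [f, ContinuousMap.coe_mk]; rw [hfour 1 z hz]; simp
    rw [this, ← ContinuousMap.sub_apply]
    refine ((f - p).norm_coe_le_norm _).trans ?_
    rw [← dist_eq_norm]; exact hpf.le
  rw [h2] at h3
  have h4 : Lam μ φ n h = (Lam μ φ n h - Lam μ φ n (fun z => p (Complex.arg z : ℝ))) +
    Lam μ φ n (fun z => p (Complex.arg z : ℝ)) := by ring
  rw [h4]
  refine (norm_add_le _ _).trans_lt ?_
  linarith

end lam

/-- finite rank sequences with bounded coefficients -/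
inductive Good : (ℕ → ℂ → ℂ) → Prop
  | base (c : ℕ → ℂ) (h : ℂ → ℂ) (hc : ∃ M : ℝ, ∀ n, ‖c n‖ ≤ M) (hh : Continuous h) :
      Good (fun n z => c n * h z)
  | add (F G : ℕ → ℂ → ℂ) : Good F → Good G → Good (fun n z => F n z + G n z)

lemma Good.nice {F : ℕ → ℂ → ℂ} (hF : Good F) (n : ℕ) : Nice (F n) := by
  induction hF with
  | base c h _ hh => exact (Nice.const _).mul (Nice.of_cont hh)
  | add F G _ _ h1 h2 => exact h1.add h2

lemma Good.bdd {F : ℕ → ℂ → ℂ} (hF : Good F) : ∃ M : ℝ, 0 ≤ M ∧ ∀ n z, ‖z‖ = 1 → ‖F n z‖ ≤ M := by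
  induction hF with
  | base c h hc hh =>
    obtain ⟨M, hM⟩ := hc
    obtain ⟨_, D, hD⟩ := Nice.of_cont hh
    have hM0 : 0 ≤ M := (norm_nonneg _).trans (hM 0)
    have hD0 : 0 ≤ D := (norm_nonneg _).trans (hD 1 (by simp))
    refine ⟨M * D, mul_nonneg hM0 hD0, fun n z hz => ?_⟩
    rw [norm_mul]
    exact mul_le_mul (hM n) (hD z hz) (norm_nonneg _) hM0
  | add F G _ _ h1 h2 =>
    obtain ⟨A, hA0, hA⟩ := h1
    obtain ⟨B, hB0, hB⟩ := h2
    exact ⟨A + B, add_nonneg hA0 hB0, fun n z hz =>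
      (norm_add_le _ _).trans (add_le_add (hA n z hz) (hB n z hz))⟩

lemma Good.conj {F : ℕ → ℂ → ℂ} (hF : Good F) : Good (fun n z => conj (F n z)) := by
  induction hF with
  | base c h hc hh =>
    simp only [map_mul]
    exact Good.base (fun n => conj (c n)) (fun z => conj (h z)) (by simpa using hc)
      (Complex.continuous_conj.comp hh)
  | add F G _ _ h1 h2 => simp only [map_add]; exact Good.add _ _ h1 h2

lemma Good.mul {F G : ℕ → ℂ → ℂ} (hF : Good F) (hG : Good G) :
    Good (fun n z => F n z * G n z) := by
  induction hF with
  | base c h hc hh =>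
    induction hG with
    | base c' h' hc' hh' =>
      obtain ⟨M, hM⟩ := hc
      obtain ⟨M', hM'⟩ := hc'
      have : (fun n z => c n * h z * (c' n * h' z)) = fun n z => (c n * c' n) * (h z * h' z) := by
        ext n z; ring
      rw [this]
      refine Good.base (fun n => c n * c' n) (fun z => h z * h' z) ⟨M * M', fun n => ?_⟩ (hh.mul hh')
      rw [norm_mul]
      exact mul_le_mul (hM n) (hM' n) (norm_nonneg _) ((norm_nonneg _).trans (hM 0))
    | add F G _ _ h1 h2 => simp only [mul_add]; exact Good.add _ _ h1 h2
  | add F G _ _ h1 h2 => simp only [add_mul]; exact Good.add _ _ h1 h2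

lemma Good.sum {F : ℕ → ℕ → ℂ → ℂ} (m : ℕ) (h : ∀ k, Good (F k)) :
    Good (fun n z => ∑ k ∈ Finset.range m, F k n z) := by
  induction m with
  | zero => simpa using Good.base 0 0 ⟨0, by simp⟩ continuous_const
  | succ m ih => simp only [Finset.sum_range_succ]; exact Good.add _ _ ih (h m)

/-- approximable sequences -/
def Apx (F : ℕ → ℂ → ℂ) : Prop :=
  ∀ ε > 0, ∃ G, Good G ∧ ∀ᶠ n in atTop, ∀ z, ‖z‖ = 1 → ‖F n z - G n z‖ ≤ ε

lemma Good.apx {F : ℕ → ℂ → ℂ} (hF : Good F) : Apx F := fun ε hε =>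
  ⟨F, hF, Eventually.of_forall fun n z _ => by simpa using hε.le⟩

lemma Apx.bdd {F : ℕ → ℂ → ℂ} (hF : Apx F) :
    ∃ M : ℝ, 0 ≤ M ∧ ∀ᶠ n in atTop, ∀ z, ‖z‖ = 1 → ‖F n z‖ ≤ M := by
  obtain ⟨G, hG, h⟩ := hF 1 one_pos
  obtain ⟨M, hM0, hM⟩ := hG.bdd
  refine ⟨M + 1, by linarith, h.mono fun n hn z hz => ?_⟩
  have := norm_add_le (F n z - G n z) (G n z)
  rw [sub_add_cancel] at this
  linarith [hn z hz, hM n z hz]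

lemma Apx.conj {F : ℕ → ℂ → ℂ} (hF : Apx F) : Apx (fun n z => conj (F n z)) := by
  intro ε hε
  obtain ⟨G, hG, h⟩ := hF ε hε
  refine ⟨_, hG.conj, h.mono fun n hn z hz => ?_⟩
  rw [← map_sub, RCLike.norm_conj]; exact hn z hz

lemma Apx.add {F G : ℕ → ℂ → ℂ} (hF : Apx F) (hG : Apx G) : Apx (fun n z => F n z + G n z) := by
  intro ε hε
  obtain ⟨F', hF', h⟩ := hF (ε / 2) (by positivity)
  obtain ⟨G', hG', h'⟩ := hG (ε / 2) (by positivity)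
  refine ⟨_, Good.add _ _ hF' hG', (h.and h').mono fun n hn z hz => ?_⟩
  have e : F n z + G n z - (F' n z + G' n z) = (F n z - F' n z) + (G n z - G' n z) := by ring
  rw [e]
  refine (norm_add_le _ _).trans ?_
  linarith [hn.1 z hz, hn.2 z hz]

lemma Apx.mul {F G : ℕ → ℂ → ℂ} (hF : Apx F) (hG : Apx G) : Apx (fun n z => F n z * G n z) := by
  intro ε hε
  obtain ⟨M, hM0, hM⟩ := hG.bdd
  obtain ⟨F', hF', h⟩ := hF (ε / 2 / (M + 1)) (by positivity)
  obtain ⟨M', hM'0, hM'⟩ := hF'.bdd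
  obtain ⟨G', hG', h'⟩ := hG (ε / 2 / (M' + 1)) (by positivity)
  refine ⟨_, hF'.mul hG', (hM.and (h.and h')).mono fun n hn z hz => ?_⟩
  obtain ⟨h1, h2, h3⟩ := hn
  have e : F n z * G n z - (F' n z * G' n z) =
    (F n z - F' n z) * G n z + F' n z * (G n z - G' n z) := by ring
  rw [e]
  refine (norm_add_le _ _).trans ?_
  rw [norm_mul, norm_mul]
  have a1 : ‖F n z - F' n z‖ * ‖G n z‖ ≤ ε / 2 / (M + 1) * (M + 1) :=
    mul_le_mul (h2 z hz) ((h1 z hz).trans (by linarith)) (norm_nonneg _) (by positivity)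
  have a2 : ‖F' n z‖ * ‖G n z - G' n z‖ ≤ (M' + 1) * (ε / 2 / (M' + 1)) :=
    mul_le_mul ((hM' n z hz).trans (by linarith)) (h3 z hz) (norm_nonneg _) (by positivity)
  have b1 : ε / 2 / (M + 1) * (M + 1) = ε / 2 := by field_simp
  have b2 : (M' + 1) * (ε / 2 / (M' + 1)) = ε / 2 := by field_simp
  linarith

lemma Good.lam (hS : ∀ᵐ z ∂μ, ‖z‖ = 1) {φ : ℕ → ℂ[X]} (hW : WOP μ 1 φ) {ρ : ℕ → ℝ} {α : ℕ → ℂ}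
    (hz : Szego φ ρ α) (hα : Tendsto α atTop (𝓝 0)) {F : ℕ → ℂ → ℂ} (hF : Good F) :
    Tendsto (fun n => Lam μ φ n (F n)) atTop (𝓝 0) := by
  induction hF with
  | base c h hc hh =>
    obtain ⟨M, hM⟩ := hc
    have := (Lam_cont hS hW hz hα hh).norm.const_mul M
    rw [norm_zero, mul_zero] at this
    refine squeeze_zero_norm (fun n => ?_) this
    rw [Lam_const, norm_mul]
    exact mul_le_mul_of_nonneg_right (hM n) (norm_nonneg _)
  | add F G hF hG h1 h2 =>
    have := h1.add h2
    rw [add_zero] at this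
    exact this.congr fun n => (Lam_add hS n (hF.nice n) (hG.nice n)).symm

lemma Apx.lam (hS : ∀ᵐ z ∂μ, ‖z‖ = 1) {φ : ℕ → ℂ[X]} (hW : WOP μ 1 φ) {ρ : ℕ → ℝ} {α : ℕ → ℂ}
    (hz : Szego φ ρ α) (hα : Tendsto α atTop (𝓝 0)) {F : ℕ → ℂ → ℂ} (hF : Apx F)
    (hN : ∀ n, Nice (F n)) :
    Tendsto (fun n => Lam μ φ n (F n)) atTop (𝓝 0) := by
  rw [Metric.tendsto_atTop]
  intro ε hε
  obtain ⟨G, hG, h⟩ := hF (ε / 2) (by positivity)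
  obtain ⟨n0, hn0⟩ := Metric.tendsto_atTop.1 (hG.lam hS hW hz hα) (ε / 2) (by positivity)
  obtain ⟨n1, hn1⟩ := eventually_atTop.1 h
  refine ⟨max n0 n1, fun n hn => ?_⟩
  have h1 := hn0 n (le_of_max_le_left hn)
  have h2 := Lam_bd hS hW n (hn1 n (le_of_max_le_right hn))
  rw [Lam_sub hS n (hN n) (hG.nice n)] at h2
  rw [dist_zero_right] at h1 ⊢
  have h4 : Lam μ φ n (F n) = (Lam μ φ n (F n) - Lam μ φ n (G n)) + Lam μ φ n (G n) := by ring
  rw [h4]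
  refine (norm_add_le _ _).trans_lt ?_
  linarith

/-- standing assumptions -/
structure Setup (μ : Measure ℂ) (φ ψ : ℕ → ℂ[X]) (ρ : ℕ → ℝ) (α : ℕ → ℂ) (g : ℂ → ℝ)
    (c M K L : ℝ) : Prop where
  hS : ∀ᵐ z ∂μ, ‖z‖ = 1
  hW : WOP μ 1 φ
  hz : Szego φ ρ α
  hα : Tendsto α atTop (𝓝 0)
  hg : Continuous g
  hc : 0 < c
  hgc : ∀ z, c ≤ g z
  hgM : ∀ z, ‖z‖ = 1 → g z ≤ M
  hK : 0 ≤ K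
  hgK : ∀ z w, |g z - g w| ≤ K * ‖z - w‖
  hψ : WOP μ (fun z => (g z : ℂ)) ψ
  hL : 0 ≤ L
  hLψ : ∀ n, NP μ (ψ n) ≤ L

/-- the difference quotient -/
def HH (g : ℂ → ℝ) (z w : ℂ) : ℂ := ((g z - g w : ℝ) : ℂ) / (1 - z * conj w)

/-- kernel integral -/
def AB (μ : Measure ℂ) (g : ℂ → ℝ) (P Q : ℂ[X]) (z : ℂ) : ℂ :=
  ∫ w, HH g z w * (conj (P.eval w) * Q.eval w) ∂μ

lemma wip_bd (hS : ∀ᵐ z ∂μ, ‖z‖ = 1) {w : ℂ → ℂ} {C : ℝ} (hC : 0 ≤ C)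
    (hb : ∀ z, ‖z‖ = 1 → ‖w z‖ ≤ C) (P Q : ℂ[X]) : ‖wip μ w P Q‖ ≤ C * (NP μ P * NP μ Q) := by
  refine (norm_integral_le_integral_norm _).trans ?_
  refine le_trans ?_ (mul_le_mul_of_nonneg_left (N_cs (Nice.poly P) (Nice.poly Q) hS) hC)
  rw [← integral_const_mul]
  refine integral_mono_of_nonneg (ae_of_all _ fun z => norm_nonneg _)
    (((Nice.poly P).int_norm_mul (Nice.poly Q) hS).const_mul _) (hS.mono fun z hz => ?_)
  simp only [norm_mul, RCLike.norm_conj]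
  exact mul_le_mul_of_nonneg_right (hb z hz) (by positivity)

lemma wip_sub_left {w : ℂ → ℂ} (hw : Nice w) (hS : ∀ᵐ z ∂μ, ‖z‖ = 1) (P Q R : ℂ[X]) :
    wip μ w (P - Q) R = wip μ w P R - wip μ w Q R := by
  unfold wip
  rw [← integral_sub (wip_int hw hS _ _) (wip_int hw hS _ _)]
  congr 1; ext z; rw [eval_sub, map_sub]; ring

lemma AB_eq_wip (g : ℂ → ℝ) (P Q : ℂ[X]) (z : ℂ) : AB μ g P Q z = wip μ (HH g z) P Q := rfl

lemma DD_mul (P Q : ℂ[X]) : DD (P * Q) = DD P * Q + P * DD Q := by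
  simp [DD, derivative_mul]; ring

lemma DD_C (c : ℂ) (P : ℂ[X]) : DD (C c * P) = C c * DD P := by simp [DD]; ring

lemma DD_C0 (c : ℂ) : DD (C c) = 0 := by simp [DD]

lemma DD_sum {ι : Type*} (s : Finset ι) (P : ι → ℂ[X]) : DD (∑ i ∈ s, P i) = ∑ i ∈ s, DD (P i) := by
  simp [DD, Finset.mul_sum]

lemma cd' {φ : ℕ → ℂ[X]} {ρ α} (h : Szego φ ρ α) (n : ℕ) (z : ℂ) :
    (1 - C (conj z) * X) * ∑ k ∈ Finset.range n, C (conj ((DD (φ k)).eval z)) * φ k =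
      C (conj ((DD (starPoly n (φ n))).eval z)) * starPoly n (φ n)
      - C (conj ((DD (φ n)).eval z)) * φ n
      + C (conj z) * (X * ∑ k ∈ Finset.range n, C (conj ((φ k).eval z)) * φ k) := by
  apply Polynomial.funext
  intro w
  have h1 := congrArg (fun P => conj (eval z (DD P))) (cd h n w)
  have e : DD (1 - C (conj w) * X) = - (C (conj w) * X) := by simp [DD]
  have e2 : ∀ P Q : ℂ[X], DD (P - Q) = DD P - DD Q := by intro P Q; simp [DD]; ring
  simp only [DD_mul, e, e2, DD_sum, DD_C0, zero_mul, zero_add] at h1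
  simp only [eval_add, eval_mul, eval_neg, eval_sub, eval_C, eval_X, eval_one, eval_finsetSum,
    map_add, map_sub, map_mul, map_neg, map_one, map_sum, Complex.conj_conj] at h1 ⊢
  have s1 : ∑ k ∈ Finset.range n, conj (eval z (DD (φ k))) * eval w (φ k)
    = ∑ k ∈ Finset.range n, eval w (φ k) * conj (eval z (DD (φ k))) :=
    Finset.sum_congr rfl fun k _ => mul_comm _ _
  have s2 : ∑ k ∈ Finset.range n, conj (eval z (φ k)) * eval w (φ k)
    = ∑ k ∈ Finset.range n, eval w (φ k) * conj (eval z (φ k)) :=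
    Finset.sum_congr rfl fun k _ => mul_comm _ _
  rw [s1, s2]
  linear_combination h1

section setup
variable {φ ψ : ℕ → ℂ[X]} {ρ : ℕ → ℝ} {α : ℕ → ℂ} {g : ℂ → ℝ} {c M K L : ℝ}
  (s : Setup μ φ ψ ρ α g c M K L)
include s

lemma HH_bd {z w : ℂ} (hz : ‖z‖ = 1) (hw : ‖w‖ = 1) : ‖HH g z w‖ ≤ K := by
  have h1 : ‖1 - z * conj w‖ = ‖z - w‖ := by
    have : z - w = - (w * (1 - z * conj w)) := by linear_combination z * (-circ_inv hw)
    rw [this, norm_neg, norm_mul, hw, one_mul]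
  rw [HH, norm_div, h1, Complex.norm_real, Real.norm_eq_abs]
  exact div_le_of_le_mul₀ (norm_nonneg _) s.hK (s.hgK z w)

omit [IsProbabilityMeasure μ] in
lemma HH_meas : Measurable (fun p : ℂ × ℂ => HH g p.1 p.2) := by
  have := s.hg.measurable
  have h2 := Complex.continuous_conj.measurable
  unfold HH
  refine Measurable.div (Complex.measurable_ofReal.comp
    ((this.comp measurable_fst).sub (this.comp measurable_snd))) ?_
  exact measurable_const.sub (measurable_fst.mul (h2.comp measurable_snd))

lemma HH_nice {z : ℂ} (hz : ‖z‖ = 1) : Nice (HH g z) :=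
  ⟨(HH_meas s).comp measurable_prodMk_left, K, fun _ hw => HH_bd s hz hw⟩

lemma AB_bd {z : ℂ} (hz : ‖z‖ = 1) (P Q : ℂ[X]) :
    ‖AB μ g P Q z‖ ≤ K * (NP μ P * NP μ Q) :=
  wip_bd s.hS s.hK (fun _ hw => HH_bd s hz hw) P Q

lemma AB_nice (P Q : ℂ[X]) : Nice (AB μ g P Q) := by
  refine ⟨?_, _, fun z hz => AB_bd s hz P Q⟩
  have : StronglyMeasurable (fun p : ℂ × ℂ => HH g p.1 p.2 * (conj (P.eval p.2) * Q.eval p.2)) := by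
    refine Measurable.stronglyMeasurable ((HH_meas s).mul (Measurable.mul ?_ ?_))
    · exact (Complex.continuous_conj.measurable.comp P.continuous.measurable).comp measurable_snd
    · exact Q.continuous.measurable.comp measurable_snd
  exact (this.integral_prod_right (ν := μ)).measurable

omit [IsProbabilityMeasure μ] in
lemma g_nice : Nice (fun z => (g z : ℂ)) := Nice.of_cont (Complex.continuous_ofReal.comp s.hg)

omit [IsProbabilityMeasure μ] in
lemma M_nonneg : 0 ≤ M := s.hc.le.trans ((s.hgc 1).trans (s.hgM 1 (by simp)))

omit [IsProbabilityMeasure μ] in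
lemma g_bd (z : ℂ) (hz : ‖z‖ = 1) : ‖(g z : ℂ)‖ ≤ M := by
  rw [Complex.norm_real, Real.norm_eq_abs, abs_of_nonneg (s.hc.le.trans (s.hgc z))]
  exact s.hgM z hz

omit [IsProbabilityMeasure μ] in
lemma g_ne (z : ℂ) : (g z : ℂ) ≠ 0 := by
  exact_mod_cast (s.hc.trans_le (s.hgc z)).ne'

/-- the key identity -/
lemma key {z : ℂ} (hz : ‖z‖ = 1) (k Q : ℂ[X]) :
    AB μ g ((1 - C (conj z) * X) * k) Q z
      = g z * wip μ 1 k Q - wip μ (fun z => (g z : ℂ)) k Q := by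
  unfold AB wip
  rw [← integral_const_mul, ← integral_sub ((wip_int nice_one s.hS k Q).const_mul _)
    (wip_int (g_nice s) s.hS k Q)]
  refine integral_congr_ae (s.hS.mono fun w hw => ?_)
  have h : HH g z w * (1 - z * conj w) = g z - g w := by
    unfold HH
    by_cases h0 : 1 - z * conj w = 0
    · have : z = w := by linear_combination (-w) * h0 - z * circ_inv hw
      simp [this]
    · rw [div_mul_cancel₀ _ h0]; push_cast; rfl
  simp only [eval_mul, eval_sub, eval_one, eval_C, eval_X, map_mul, map_sub, map_one,
    Complex.conj_conj, Pi.one_apply]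
  linear_combination (conj (eval w k) * eval w Q) * h

/-- the reproducing kernel -/
lemma ident0 (n : ℕ) (D : ℂ[X] →ₗ[ℂ] ℂ[X]) {z : ℂ} (hz : ‖z‖ = 1) :
    g z * (D (ψ n)).eval z = g z * wip μ 1 (φ n) (ψ n) * (D (φ n)).eval z +
      AB μ g ((1 - C (conj z) * X) *
        ∑ k ∈ Finset.range n, C (conj ((D (φ k)).eval z)) * φ k) (ψ n) z := by
  have hlow : (∑ k ∈ Finset.range n, C (conj ((D (φ k)).eval z)) * φ k).degree < n := by
    rw [degree_lt_iff_coeff_zero]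
    intro j hj
    rw [finsetSum_coeff]
    refine Finset.sum_eq_zero fun k hk => ?_
    rw [coeff_C_mul, coeff_eq_zero_of_natDegree_lt, mul_zero]
    rw [s.hW.natDeg]; simp at hk; omega
  rw [key s hz, s.hψ.low (g_nice s) s.hS hlow, sub_zero, wip_sum_left nice_one s.hS]
  have hd : (ψ n).degree < (n + 1 : ℕ) := by
    rw [s.hψ.deg]; exact_mod_cast n.lt_succ_self
  have h := congrArg (fun P => eval z (D P)) (s.hW.repr nice_one s.hS hd)
  simp only [C_mul', map_add, eval_add, map_sum, map_smul, eval_finsetSum, eval_smul, smul_eq_mul,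
    Finset.sum_range_succ] at h
  rw [h]
  simp only [wip_C_left, Complex.conj_conj]
  rw [mul_add, add_comm, mul_assoc]
  congr 2
  exact Finset.sum_congr rfl fun k _ => mul_comm _ _

lemma ident1 (n : ℕ) {z : ℂ} (hz : ‖z‖ = 1) :
    g z * (ψ n).eval z = (wip μ 1 (φ n) (ψ n) * g z - AB μ g (φ n) (ψ n) z) * (φ n).eval z +
      AB μ g (starPoly n (φ n)) (ψ n) z * (starPoly n (φ n)).eval z := by
  have h := ident0 s n LinearMap.id hz
  simp only [LinearMap.id_apply] at h
  rw [cd s.hz n z, AB_eq_wip, wip_sub_left (HH_nice s hz) s.hS, wip_C_left, wip_C_left,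
    Complex.conj_conj, Complex.conj_conj] at h
  rw [AB_eq_wip, AB_eq_wip]
  linear_combination h

end setup

section mom
variable (hS : ∀ᵐ z ∂μ, ‖z‖ = 1) {φ : ℕ → ℂ[X]} (hW : WOP μ 1 φ) {ρ : ℕ → ℝ} {α : ℕ → ℂ}
    (hz : Szego φ ρ α) (hα : Tendsto α atTop (𝓝 0))
include hS

lemma ip_Xpow (k : ℕ) (P Q : ℂ[X]) : wip μ 1 (X ^ k * P) (X ^ k * Q) = wip μ 1 P Q := by
  induction k with
  | zero => simp
  | succ k ih => rw [pow_succ', mul_assoc, mul_assoc, ip_X hS, ih]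

include hW hz hα

lemma mom (j l : ℕ) : Tendsto (fun n => ‖wip μ 1 (X ^ j * φ n) (X ^ l * φ n)‖) atTop
    (𝓝 (if j = l then 1 else 0)) := by
  rcases lt_trichotomy j l with h | h | h
  · rw [if_neg h.ne]
    have := (mom1 hS hW hz hα (l - j) (by omega)).norm
    rw [norm_zero] at this
    refine this.congr fun n => ?_
    rw [← ip_Xpow hS j, ← mul_assoc, ← pow_add, Nat.add_sub_cancel' h.le]
  · subst h
    simp [ip_Xpow hS, hW.orth]
  · rw [if_neg h.ne']
    have := (mom1 hS hW hz hα (j - l) (by omega)).norm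
    rw [norm_zero] at this
    refine this.congr fun n => ?_
    rw [← ip_Xpow hS l, ← mul_assoc, ← pow_add, Nat.add_sub_cancel' h.le, ← ip_conj,
      RCLike.norm_conj]

/-- Fejer-type averaging polynomial -/
def Sz (m : ℕ) (z : ℂ) : ℂ[X] := C ((1 : ℂ) / m) * ∑ j ∈ Finset.range m, (C (conj z) * X) ^ j

omit [IsProbabilityMeasure μ] hS hW hz hα in
lemma Sz_mul (m : ℕ) (z : ℂ) (P : ℂ[X]) :
    Sz m z * P = ∑ j ∈ Finset.range m, C ((1 : ℂ) / m * conj z ^ j) * (X ^ j * P) := by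
  rw [Sz, mul_assoc, Finset.sum_mul, Finset.mul_sum]
  refine Finset.sum_congr rfl fun j _ => ?_
  rw [C_mul, mul_pow, C_pow]; ring

omit hW hz hα in
lemma Sz_norm (m n : ℕ) {z : ℂ} (hz : ‖z‖ = 1) : NP μ (Sz m z * φ n) ^ 2 ≤
    (1 / m) ^ 2 * ∑ j ∈ Finset.range m, ∑ l ∈ Finset.range m,
      ‖wip μ 1 (X ^ j * φ n) (X ^ l * φ n)‖ := by
  have h : NP μ (Sz m z * φ n) ^ 2 = ‖wip μ 1 (Sz m z * φ n) (Sz m z * φ n)‖ := by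
    rw [← NP_sq, Complex.norm_real, Real.norm_of_nonneg (by positivity)]
  rw [h, Sz_mul, wip_sum_left nice_one hS, Finset.mul_sum]
  refine (norm_sum_le _ _).trans (Finset.sum_le_sum fun j _ => ?_)
  rw [wip_C_left, wip_sum_right nice_one hS, Finset.mul_sum, Finset.mul_sum]
  refine (norm_sum_le _ _).trans (Finset.sum_le_sum fun l _ => ?_)
  rw [wip_C_right]
  simp only [norm_mul, RCLike.norm_conj, norm_pow, hz, norm_div, one_pow, mul_one, norm_one,
    RCLike.norm_natCast]
  apply le_of_eq; ring

lemma Sz_small {δ : ℝ} (hδ : 0 < δ) : ∃ m : ℕ, 1 ≤ m ∧ ∀ᶠ n in atTop, ∀ z, ‖z‖ = 1 →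
    NP μ (Sz m z * φ n) ≤ δ := by
  obtain ⟨m, hm⟩ := exists_nat_gt (1 / δ ^ 2)
  have hm0 : (0 : ℝ) < m := lt_trans (by positivity) hm
  refine ⟨m, by exact_mod_cast hm0, ?_⟩
  have ht : Tendsto (fun n => (1 / (m : ℝ)) ^ 2 * ∑ j ∈ Finset.range m, ∑ l ∈ Finset.range m,
      ‖wip μ 1 (X ^ j * φ n) (X ^ l * φ n)‖) atTop
      (𝓝 ((1 / (m : ℝ)) ^ 2 * ∑ j ∈ Finset.range m, ∑ l ∈ Finset.range m,
        if j = l then 1 else 0)) :=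
    (tendsto_finsetSum _ fun j _ => tendsto_finsetSum _ fun l _ => mom hS hW hz hα j l).const_mul _
  have e : (1 / (m : ℝ)) ^ 2 * ∑ j ∈ Finset.range m, ∑ l ∈ Finset.range m,
        (if j = l then (1 : ℝ) else 0) = 1 / m := by
    have : ∑ j ∈ Finset.range m, ∑ l ∈ Finset.range m, (if j = l then (1 : ℝ) else 0)
        = ∑ j ∈ Finset.range m, 1 := by
      refine Finset.sum_congr rfl fun j hj => ?_
      rw [Finset.sum_ite_eq, if_pos hj]
    rw [this]; simp; field_simp
  rw [e] at ht
  have hlt : 1 / (m : ℝ) < δ ^ 2 := by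
    rw [div_lt_iff₀ (by positivity)] at hm ⊢; linarith
  refine (ht.eventually_lt_const hlt).mono fun n hn z hz => ?_
  exact (sq_le_sq₀ (NP_nonneg _) hδ.le).1 ((Sz_norm hS m n hz).trans hn.le)

end mom

/-- complementary kernel -/
def Kz (m : ℕ) (z : ℂ) : ℂ[X] :=
  ∑ j ∈ Finset.range m, ∑ i ∈ Finset.range j, C ((1 : ℂ) / m) * (C (conj z) * X) ^ i

lemma Sz_Kz {m : ℕ} (hm : 1 ≤ m) (z : ℂ) (P : ℂ[X]) :
    P = Sz m z * P + (1 - C (conj z) * X) * (Kz m z * P) := by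
  have h1 : (1 - C (conj z) * X) * Kz m z = 1 - Sz m z := by
    have e : ∀ j ∈ Finset.range m, (1 - C (conj z) * X) *
        ∑ i ∈ Finset.range j, C ((1 : ℂ) / m) * (C (conj z) * X) ^ i =
        C ((1 : ℂ) / m) - C ((1 : ℂ) / m) * (C (conj z) * X) ^ j := by
      intro j _
      rw [← Finset.mul_sum, mul_left_comm, mul_neg_geom_sum]; ring
    rw [Kz, Finset.mul_sum, Finset.sum_congr rfl e, Finset.sum_sub_distrib, Sz, Finset.mul_sum]
    congr 1
    have : (m : ℂ) ≠ 0 := by exact_mod_cast (by omega : m ≠ 0)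
    rw [Finset.sum_const, Finset.card_range, nsmul_eq_mul, ← C_eq_natCast, ← C_mul,
      mul_one_div_cancel this, C_1]
  rw [← mul_assoc, h1]; ring

lemma Kz_wip {w : ℂ → ℂ} (hw : Nice w) (hS : ∀ᵐ z ∂μ, ‖z‖ = 1) (m : ℕ) (z : ℂ) (P Q : ℂ[X]) :
    wip μ w (Kz m z * P) Q = ∑ j ∈ Finset.range m, ∑ i ∈ Finset.range j,
      (1 : ℂ) / m * z ^ i * wip μ w (X ^ i * P) Q := by
  rw [Kz, Finset.sum_mul, wip_sum_left hw hS]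
  refine Finset.sum_congr rfl fun j _ => ?_
  rw [Finset.sum_mul, wip_sum_left hw hS]
  refine Finset.sum_congr rfl fun i _ => ?_
  have : C ((1 : ℂ) / m) * (C (conj z) * X) ^ i * P = C ((1 : ℂ) / m * conj z ^ i) * (X ^ i * P) := by
    rw [C_mul, mul_pow, C_pow]; ring
  rw [this, wip_C_left]
  simp

section setup
variable {φ ψ : ℕ → ℂ[X]} {ρ : ℕ → ℝ} {α : ℕ → ℂ} {g : ℂ → ℝ} {c M K L : ℝ}
  (s : Setup μ φ ψ ρ α g c M K L)
include s

lemma AB_apx {p : ℕ → ℂ[X]} (hp : ∀ n z, ‖z‖ = 1 → ‖(p n).eval z‖ = ‖(φ n).eval z‖) :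
    Apx (fun n z => AB μ g (p n) (ψ n) z) := by
  intro ε hε
  have hK := s.hK
  have hL := s.hL
  have hpn : ∀ i n, NP μ (X ^ i * p n) = 1 := fun i n => by
    rw [NP_Xpow s.hS, ← NP_phi s.hW n]
    exact N_congr s.hS fun z hz => hp n z hz
  obtain ⟨m, hm, hsm⟩ := Sz_small s.hS s.hW s.hz s.hα
    (show 0 < ε / (K * L + 1) by positivity)
  refine ⟨fun n z => ∑ j ∈ Finset.range m, ∑ i ∈ Finset.range j,
    (wip μ 1 (X ^ i * p n) (ψ n) * ((1 : ℂ) / m * z ^ i * g z) +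
      wip μ (fun z => (g z : ℂ)) (X ^ i * p n) (ψ n) * (-((1 : ℂ) / m * z ^ i))), ?_, ?_⟩
  · refine Good.sum m fun j => Good.sum j fun i => Good.add _ _ ?_ ?_
    · refine Good.base _ _ ⟨L, fun n => ?_⟩ ?_
      · refine (ip_le s.hS _ _).trans ?_
        rw [hpn, one_mul]; exact s.hLψ n
      · exact (continuous_const.mul (continuous_pow i)).mul (Complex.continuous_ofReal.comp s.hg)
    · refine Good.base _ _ ⟨M * L, fun n => ?_⟩ ?_
      · refine (wip_bd s.hS (M_nonneg s) (g_bd s) _ _).trans ?_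
        rw [hpn, one_mul]; exact mul_le_mul_of_nonneg_left (s.hLψ n) (M_nonneg s)
      · exact (continuous_const.mul (continuous_pow i)).neg
  · refine hsm.mono fun n hn z hz => ?_
    have e : AB μ g (p n) (ψ n) z - ∑ j ∈ Finset.range m, ∑ i ∈ Finset.range j,
      (wip μ 1 (X ^ i * p n) (ψ n) * ((1 : ℂ) / m * z ^ i * g z) +
      wip μ (fun z => (g z : ℂ)) (X ^ i * p n) (ψ n) * (-((1 : ℂ) / m * z ^ i)))
      = AB μ g (Sz m z * p n) (ψ n) z := by
      have h1 : AB μ g (p n) (ψ n) z = AB μ g (Sz m z * p n) (ψ n) z +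
          AB μ g ((1 - C (conj z) * X) * (Kz m z * p n)) (ψ n) z := by
        conv_lhs => rw [Sz_Kz hm z (p n)]
        rw [AB_eq_wip, wip_add_left (HH_nice s hz) s.hS]; rfl
      rw [h1, key s hz, Kz_wip nice_one s.hS, Kz_wip (g_nice s) s.hS, Finset.mul_sum,
        ← Finset.sum_sub_distrib, add_sub_assoc, ← Finset.sum_sub_distrib]
      rw [Finset.sum_eq_zero, add_zero]
      intro j _
      rw [Finset.mul_sum, ← Finset.sum_sub_distrib, ← Finset.sum_sub_distrib]
      refine Finset.sum_eq_zero fun i _ => ?_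
      ring
    rw [e]
    refine (AB_bd s hz _ _).trans ?_
    have e2 : NP μ (Sz m z * p n) = NP μ (Sz m z * φ n) :=
      N_congr s.hS fun w hw => by simp [hp n w hw]
    rw [e2]
    calc K * (NP μ (Sz m z * φ n) * NP μ (ψ n)) ≤ K * (ε / (K * L + 1) * L) := by
          refine mul_le_mul_of_nonneg_left (mul_le_mul (hn z hz) (s.hLψ n) (NP_nonneg _) ?_) hK
          positivity
      _ = ε * (K * L) / (K * L + 1) := by ring
      _ ≤ ε := by
          rw [div_le_iff₀ (by positivity)]; nlinarith

end setup

/-- `z d/dz` as a linear map -/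
def DDl : ℂ[X] →ₗ[ℂ] ℂ[X] where
  toFun := DD
  map_add' P Q := by simp [DD, mul_add]
  map_smul' a P := by simp [DD]

lemma DDl_apply (P : ℂ[X]) : DDl P = DD P := rfl

/-- the deviation polynomial -/
def qq (φ : ℕ → ℂ[X]) (n : ℕ) : ℂ[X] := DD (φ n) - C (n : ℂ) * φ n

lemma pyth {w : ℂ → ℂ} (hw : Nice w) (hS : ∀ᵐ z ∂μ, ‖z‖ = 1) {ψ : ℕ → ℂ[X]} (h : WOP μ w ψ)
    (n : ℕ) : wip μ w (DD (ψ n)) (DD (ψ n)) = (n : ℂ) ^ 2 + wip μ w (qq ψ n) (qq ψ n) := by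
  have e : DD (ψ n) = C (n : ℂ) * ψ n + qq ψ n := by rw [qq]; ring
  have hq : (qq ψ n).degree < n := DD_sub_degree (h.natDeg n).le
  rw [e, wip_add_right hw hS, wip_add_left hw hS, wip_add_left hw hS, wip_C_left, wip_C_left,
    wip_C_right, wip_C_right, h.low hw hS hq, h.low' hw hS hq, h.orth, if_pos rfl]
  simp; ring

lemma wip_DD {w : ℂ → ℂ} (hw : Nice w) (hS : ∀ᵐ z ∂μ, ‖z‖ = 1) {ψ : ℕ → ℂ[X]} (h : WOP μ w ψ)
    (n : ℕ) : wip μ w (ψ n) (DD (ψ n)) = n := by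
  have e : DD (ψ n) = C (n : ℂ) * ψ n + qq ψ n := by rw [qq]; ring
  have hq : (qq ψ n).degree < n := DD_sub_degree (h.natDeg n).le
  rw [e, wip_add_right hw hS, wip_C_right, h.low' hw hS hq, h.orth, if_pos rfl]
  simp

/-- reproducing kernel -/
def kz (φ : ℕ → ℂ[X]) (n : ℕ) (z : ℂ) : ℂ[X] :=
  ∑ k ∈ Finset.range n, C (conj ((φ k).eval z)) * φ k

lemma kz_norm (hS : ∀ᵐ z ∂μ, ‖z‖ = 1) {φ : ℕ → ℂ[X]} (hW : WOP μ 1 φ) (n : ℕ) (z : ℂ) :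
    NP μ (kz φ n z) = Real.sqrt (∑ k ∈ Finset.range n, ‖(φ k).eval z‖ ^ 2) := by
  have h : ((NP μ (kz φ n z) ^ 2 : ℝ) : ℂ) = ((∑ k ∈ Finset.range n, ‖(φ k).eval z‖ ^ 2 : ℝ) : ℂ) := by
    rw [NP_sq, kz, wip_sum_left nice_one hS, Complex.ofReal_sum]
    refine Finset.sum_congr rfl fun k hk => ?_
    rw [wip_C_left, wip_sum_right nice_one hS, Finset.sum_eq_single k]
    · rw [wip_C_right, hW.orth, if_pos rfl, mul_one, Complex.conj_conj, Complex.mul_conj,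
        Complex.normSq_eq_norm_sq]
    · intro j _ hj
      rw [wip_C_right, hW.orth, if_neg (Ne.symm hj), mul_zero]
    · exact fun h => absurd hk h
  have h := Complex.ofReal_injective h
  rw [← h, Real.sqrt_sq (NP_nonneg _)]

/-- square root of the Christoffel sum -/
def cs (φ : ℕ → ℂ[X]) (n : ℕ) (z : ℂ) : ℂ :=
  ((Real.sqrt (∑ k ∈ Finset.range n, ‖(φ k).eval z‖ ^ 2) : ℝ) : ℂ)

lemma cs_nice (φ : ℕ → ℂ[X]) (n : ℕ) : Nice (cs φ n) := by
  refine Nice.of_cont (Complex.continuous_ofReal.comp (Real.continuous_sqrt.comp ?_))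
  exact continuous_finsetSum _ fun k _ => ((φ k).continuous.norm.pow 2)

lemma cs_norm (hS : ∀ᵐ z ∂μ, ‖z‖ = 1) {φ : ℕ → ℂ[X]} (hW : WOP μ 1 φ) (n : ℕ) :
    N μ (cs φ n) = Real.sqrt n := by
  have e : ∀ z, ‖cs φ n z‖ ^ 2 = ∑ k ∈ Finset.range n, ‖(φ k).eval z‖ ^ 2 := by
    intro z
    rw [cs, Complex.norm_real, Real.norm_of_nonneg (Real.sqrt_nonneg _), Real.sq_sqrt]
    exact Finset.sum_nonneg fun _ _ => by positivity
  rw [N]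
  congr 1
  simp only [e]
  rw [integral_finsetSum _ fun k _ => (Nice.poly (φ k)).int_sq hS]
  have : ∀ k ∈ Finset.range n, ∫ z, ‖(φ k).eval z‖ ^ 2 ∂μ = 1 := by
    intro k _
    rw [← N_sq, show N μ (fun z => (φ k).eval z) = 1 from NP_phi hW k, one_pow]
  rw [Finset.sum_congr rfl this]; simp

section setup
variable {φ ψ : ℕ → ℂ[X]} {ρ : ℕ → ℝ} {α : ℕ → ℂ} {g : ℂ → ℝ} {c M K L : ℝ}
  (s : Setup μ φ ψ ρ α g c M K L)
include s

lemma ident2 (n : ℕ) {z : ℂ} (hz : ‖z‖ = 1) :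
    g z * (DD (ψ n)).eval z =
      (wip μ 1 (φ n) (ψ n) * g z - AB μ g (φ n) (ψ n) z) * (DD (φ n)).eval z +
      AB μ g (starPoly n (φ n)) (ψ n) z * (DD (starPoly n (φ n))).eval z +
      AB μ g (C (conj z) * (X * kz φ n z)) (ψ n) z := by
  have h := ident0 s n DDl hz
  simp only [DDl_apply] at h
  rw [cd' s.hz n z, AB_eq_wip, wip_add_left (HH_nice s hz) s.hS,
    wip_sub_left (HH_nice s hz) s.hS, wip_C_left (starPoly n (φ n)), wip_C_left (φ n),
    Complex.conj_conj, Complex.conj_conj] at h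
  rw [AB_eq_wip, AB_eq_wip, AB_eq_wip, kz]
  linear_combination h

lemma a_bd (n : ℕ) : ‖wip μ 1 (φ n) (ψ n)‖ ≤ L := by
  refine (ip_le s.hS _ _).trans ?_
  rw [NP_phi s.hW, one_mul]; exact s.hLψ n

lemma A_bd (n : ℕ) {z : ℂ} (hz : ‖z‖ = 1) : ‖AB μ g (starPoly n (φ n)) (ψ n) z‖ ≤ K * L := by
  refine (AB_bd s hz _ _).trans ?_
  rw [NP_fs s.hS s.hW, one_mul]; exact mul_le_mul_of_nonneg_left (s.hLψ n) s.hK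

lemma B_bd (n : ℕ) {z : ℂ} (hz : ‖z‖ = 1) : ‖AB μ g (φ n) (ψ n) z‖ ≤ K * L := by
  refine (AB_bd s hz _ _).trans ?_
  rw [NP_phi s.hW, one_mul]; exact mul_le_mul_of_nonneg_left (s.hLψ n) s.hK

lemma R_bd (n : ℕ) {z : ℂ} (hz : ‖z‖ = 1) :
    ‖AB μ g (C (conj z) * (X * kz φ n z)) (ψ n) z‖ ≤ K * L * ‖cs φ n z‖ := by
  refine (AB_bd s hz _ _).trans ?_
  have h : NP μ (C (conj z) * (X * kz φ n z)) ≤ ‖cs φ n z‖ := by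
    refine (NP_C s.hS _ _).trans ?_
    rw [NP_X s.hS, kz_norm s.hS s.hW, cs, Complex.norm_real,
      Real.norm_of_nonneg (Real.sqrt_nonneg _)]
    simp [hz]
  rw [mul_assoc, mul_comm L]
  refine mul_le_mul_of_nonneg_left (mul_le_mul h (s.hLψ n) (NP_nonneg _) (norm_nonneg _)) s.hK

omit s [IsProbabilityMeasure μ] in
/-- coefficient of the leading part -/
def cf (μ : Measure ℂ) (φ ψ : ℕ → ℂ[X]) (g : ℂ → ℝ) (n : ℕ) (z : ℂ) : ℂ :=
  wip μ 1 (φ n) (ψ n) * g z - AB μ g (φ n) (ψ n) z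

omit s [IsProbabilityMeasure μ] in
/-- the error part -/
def ee (μ : Measure ℂ) (φ ψ : ℕ → ℂ[X]) (g : ℂ → ℝ) (n : ℕ) (z : ℂ) : ℂ :=
  AB μ g (starPoly n (φ n)) (ψ n) z * (starPoly n (φ n)).eval z

omit s [IsProbabilityMeasure μ] in
/-- the small part -/
def SS (μ : Measure ℂ) (φ ψ : ℕ → ℂ[X]) (g : ℂ → ℝ) (n : ℕ) (z : ℂ) : ℂ :=
  (1 / (n : ℂ)) * (g z * (DD (ψ n)).eval z) - cf μ φ ψ g n z * (φ n).eval z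

lemma cf_nice (n : ℕ) : Nice (cf μ φ ψ g n) :=
  ((Nice.const _).mul (g_nice s)).sub (AB_nice s _ _)

lemma ee_nice (n : ℕ) : Nice (ee μ φ ψ g n) := (AB_nice s _ _).mul (Nice.poly _)

lemma SS_nice (n : ℕ) : Nice (SS μ φ ψ g n) :=
  ((Nice.const _).mul ((g_nice s).mul (Nice.poly _))).sub ((cf_nice s n).mul (Nice.poly _))

lemma cf_bd (n : ℕ) {z : ℂ} (hz : ‖z‖ = 1) : ‖cf μ φ ψ g n z‖ ≤ L * M + K * L := by
  refine (norm_sub_le _ _).trans (add_le_add ?_ (B_bd s n hz))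
  rw [norm_mul]
  exact mul_le_mul (a_bd s n) (g_bd s z hz) (norm_nonneg _) s.hL

lemma SS_bd (n : ℕ) (hn : 1 ≤ n) : N μ (SS μ φ ψ g n) ≤
    (L * M + 2 * (K * L)) * (NP μ (qq φ n) / n) + K * L * (Real.sqrt n / n) := by
  have hn0 : (n : ℂ) ≠ 0 := by exact_mod_cast (by omega : n ≠ 0)
  have hn1 : (0 : ℝ) < n := by exact_mod_cast hn
  have hL := s.hL
  have hK := s.hK
  have hM := M_nonneg s
  have hdeg : (φ n).natDegree ≤ n := (s.hW.natDeg n).le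
  have hqd : (qq φ n).natDegree ≤ n := by
    exact natDegree_le_of_degree_le (DD_sub_degree hdeg).le
  let T : ℂ → ℂ := fun z => (1 / (n : ℂ)) * (qq φ n).eval z
  let U : ℂ → ℂ := fun z => (1 / (n : ℂ)) * cs φ n z
  have hT : Nice T := (Nice.const _).mul (Nice.poly _)
  have hU : Nice U := (Nice.const _).mul (cs_nice φ n)
  have nT : N μ T ≤ 1 / n * NP μ (qq φ n) :=
    N_mono (Nice.poly _) s.hS (by positivity) fun z _ => by simp [T]
  have nU : N μ U ≤ 1 / n * Real.sqrt n := by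
    rw [← cs_norm s.hS s.hW n]
    exact N_mono (cs_nice φ n) s.hS (by positivity) fun z _ => by simp [U]
  let P1 : ℂ → ℂ := fun z => ((L * M + 2 * (K * L) : ℝ) : ℂ) * (‖T z‖ : ℂ)
  let P2 : ℂ → ℂ := fun z => ((K * L : ℝ) : ℂ) * (‖U z‖ : ℂ)
  have nn : ∀ {f : ℂ → ℂ}, Nice f → Nice (fun z => (‖f z‖ : ℂ)) := fun {f} hf =>
    ⟨Complex.measurable_ofReal.comp hf.1.norm, hf.2.imp fun C hC z hz => by simpa using hC z hz⟩
  have hP1 : Nice P1 := (Nice.const _).mul (nn hT)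
  have hP2 : Nice P2 := (Nice.const _).mul (nn hU)
  have b1 : N μ P1 ≤ (L * M + 2 * (K * L)) * N μ T :=
    N_mono hT s.hS (by positivity) fun z _ => by
      simp only [P1, norm_mul, Complex.norm_real, norm_norm]
      rw [Real.norm_of_nonneg (by positivity)]
  have b2 : N μ P2 ≤ (K * L) * N μ U :=
    N_mono hU s.hS (by positivity) fun z _ => by
      simp only [P2, Complex.norm_mul, Complex.norm_real, norm_norm]
      rw [Real.norm_of_nonneg (by positivity)]
  have b0 : N μ (SS μ φ ψ g n) ≤ 1 * N μ (fun z => P1 z + P2 z) := by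
    refine N_mono (hP1.add hP2) s.hS zero_le_one fun z hz => ?_
    have e : SS μ φ ψ g n z = cf μ φ ψ g n z * T z +
        AB μ g (starPoly n (φ n)) (ψ n) z * ((1 / (n : ℂ)) * (DD (starPoly n (φ n))).eval z) +
        (1 / (n : ℂ)) * AB μ g (C (conj z) * (X * kz φ n z)) (ψ n) z := by
      rw [SS, ident2 s n hz]
      simp only [T, qq, cf, eval_sub, eval_mul, eval_C]
      field_simp
      ring
    have e2 : ‖(1 / (n : ℂ)) * (DD (starPoly n (φ n))).eval z‖ = ‖T z‖ := by
      simp only [T, norm_mul]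
      congr 1
      rw [DD_star hdeg, eval_neg, norm_neg, ← qq, star_norm hqd hz]
    have e3 : ‖P1 z + P2 z‖ = (L * M + 2 * (K * L)) * ‖T z‖ + (K * L) * ‖U z‖ := by
      simp only [P1, P2]
      rw [← Complex.ofReal_mul, ← Complex.ofReal_mul, ← Complex.ofReal_add, Complex.norm_real,
        Real.norm_of_nonneg (by positivity)]
    rw [e3, one_mul, e]
    refine (norm_add_le _ _).trans (le_trans (add_le_add (norm_add_le _ _) le_rfl) ?_)
    rw [norm_mul (cf μ φ ψ g n z), norm_mul (AB μ g (starPoly n (φ n)) (ψ n) z), e2,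
      norm_mul (1 / (n : ℂ)) (AB μ g (C (conj z) * (X * kz φ n z)) (ψ n) z)]
    have i1 := mul_le_mul_of_nonneg_right (cf_bd s n hz) (norm_nonneg (T z))
    have i2 := mul_le_mul_of_nonneg_right (A_bd s n hz) (norm_nonneg (T z))
    have i3 := mul_le_mul_of_nonneg_left (R_bd s n hz) (norm_nonneg (1 / (n : ℂ)))
    have e4 : ‖U z‖ = ‖1 / (n : ℂ)‖ * ‖cs φ n z‖ := by simp only [U, norm_mul]
    rw [e4]
    nlinarith
  have b3 := N_add hP1 hP2 s.hS
  have c1 := mul_le_mul_of_nonneg_left nT (show 0 ≤ L * M + 2 * (K * L) by positivity)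
  have c2 := mul_le_mul_of_nonneg_left nU (show 0 ≤ K * L by positivity)
  have d1 : 1 / (n : ℝ) * NP μ (qq φ n) = NP μ (qq φ n) / n := by ring
  have d2 : 1 / (n : ℝ) * Real.sqrt n = Real.sqrt n / n := by ring
  rw [d1] at c1
  rw [d2] at c2
  linarith

lemma SS_lim (hq : Tendsto (fun n => NP μ (qq φ n) / n) atTop (𝓝 0)) :
    Tendsto (fun n => N μ (SS μ φ ψ g n)) atTop (𝓝 0) := by
  have h2 : Tendsto (fun n : ℕ => Real.sqrt n / n) atTop (𝓝 0) := by
    have : Tendsto (fun n : ℕ => (Real.sqrt n)⁻¹) atTop (𝓝 0) :=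
      tendsto_inv_atTop_zero.comp (Real.tendsto_sqrt_atTop.comp tendsto_natCast_atTop_atTop)
    refine this.congr fun n => ?_
    rw [Real.sqrt_div_self', one_div]
  have h3 := (hq.const_mul (L * M + 2 * (K * L))).add (h2.const_mul (K * L))
  rw [mul_zero, mul_zero, add_zero] at h3
  refine squeeze_zero' (Eventually.of_forall fun n => N_nonneg _) ?_ h3
  filter_upwards [eventually_ge_atTop 1] with n hn
  exact SS_bd s n hn

lemma u_eq (n : ℕ) (hn : 1 ≤ n) : ∫ z, conj ((ψ n).eval z) * ee μ φ ψ g n z ∂μ =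
    ∫ z, conj ((ψ n).eval z) * SS μ φ ψ g n z ∂μ := by
  have hn0 : (n : ℂ) ≠ 0 := by exact_mod_cast (by omega : n ≠ 0)
  have h1 := wip_DD (g_nice s) s.hS s.hψ n
  have h2 := s.hψ.orth n n
  rw [if_pos rfl] at h2
  have hψ := (Nice.poly (ψ n)).conj
  rw [← sub_eq_zero, ← integral_sub ((hψ.mul (ee_nice s n)).int s.hS)
    ((hψ.mul (SS_nice s n)).int s.hS)]
  have e : ∫ z, (conj ((ψ n).eval z) * ee μ φ ψ g n z - conj ((ψ n).eval z) * SS μ φ ψ g n z) ∂μ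
      = ∫ z, ((g z : ℂ) * (conj ((ψ n).eval z) * (ψ n).eval z) -
        (1 / (n : ℂ)) * ((g z : ℂ) * (conj ((ψ n).eval z) * (DD (ψ n)).eval z))) ∂μ := by
    refine integral_congr_ae (s.hS.mono fun z hz => ?_)
    have := ident1 s n hz
    simp only [ee, SS, cf]
    linear_combination (-conj ((ψ n).eval z)) * this
  rw [e, integral_sub (wip_int (g_nice s) s.hS _ _) ((wip_int (g_nice s) s.hS _ _).const_mul _),
    integral_const_mul]
  unfold wip at h1 h2
  rw [h1, h2, one_div_mul_cancel hn0, sub_self]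

omit s [IsProbabilityMeasure μ] in
/-- weighted error -/
def VV (μ : Measure ℂ) (φ ψ : ℕ → ℂ[X]) (g : ℂ → ℝ) (n : ℕ) : ℝ :=
  ∫ z, ‖ee μ φ ψ g n z‖ ^ 2 / g z ∂μ

lemma ginv_cont : Continuous (fun z => ((g z)⁻¹ : ℂ)) :=
  (Complex.continuous_ofReal.comp s.hg).inv₀ (g_ne s)

omit s [IsProbabilityMeasure μ] in
/-- the symbol -/
def FF (μ : Measure ℂ) (φ ψ : ℕ → ℂ[X]) (g : ℂ → ℝ) (n : ℕ) (z : ℂ) : ℂ :=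
  AB μ g (starPoly n (φ n)) (ψ n) z * conj (cf μ φ ψ g n z) * (g z : ℂ)⁻¹

lemma FF_nice (n : ℕ) : Nice (FF μ φ ψ g n) :=
  ((AB_nice s _ _).mul (cf_nice s n).conj).mul (Nice.of_cont (ginv_cont s))

lemma FF_apx : Apx (FF μ φ ψ g) := by
  have h1 : Apx (fun n z => AB μ g (starPoly n (φ n)) (ψ n) z) :=
    AB_apx s (p := fun n => starPoly n (φ n)) fun n z hz => star_norm (s.hW.natDeg n).le hz
  have h2 : Apx (fun n z => AB μ g (φ n) (ψ n) z) := AB_apx s (p := φ) fun n z _ => rfl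
  have h3 : Apx (fun n z => wip μ 1 (φ n) (ψ n) * g z) :=
    (Good.base _ _ ⟨L, a_bd s⟩ (Complex.continuous_ofReal.comp s.hg)).apx
  have h4 : Apx (fun (_ : ℕ) (z : ℂ) => (1 : ℂ) * ((g z)⁻¹ : ℂ)) :=
    (Good.base (fun _ => 1) _ ⟨1, fun _ => by simp⟩ (ginv_cont s)).apx
  have h5 : Apx (fun (_ : ℕ) (_ : ℂ) => (1 : ℂ) * (-1 : ℂ)) :=
    (Good.base (fun _ => 1) (fun _ => -1) ⟨1, fun _ => by simp⟩ continuous_const).apx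
  have h6 := (h1.mul (h3.add (h5.mul h2)).conj).mul h4
  have e : FF μ φ ψ g = fun n z => AB μ g (starPoly n (φ n)) (ψ n) z *
      conj (wip μ 1 (φ n) (ψ n) * g z + 1 * (-1) * AB μ g (φ n) (ψ n) z) *
      (1 * ((g z)⁻¹ : ℂ)) := by
    ext n z
    simp only [FF, cf, one_mul, neg_mul, sub_eq_add_neg]
  rw [e]; exact h6

lemma VV_eq (n : ℕ) : ((VV μ φ ψ g n : ℝ) : ℂ) =
    ∫ z, conj ((ψ n).eval z) * ee μ φ ψ g n z ∂μ - Lam μ φ n (FF μ φ ψ g n) := by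
  rw [VV, ← integral_complex_ofReal, Lam, ← integral_sub
    (((Nice.poly (ψ n)).conj.mul (ee_nice s n)).int s.hS) (wip_int (FF_nice s n) s.hS _ _)]
  refine integral_congr_ae (s.hS.mono fun z hz => ?_)
  have h := ident1 s n hz
  have h' : (ψ n).eval z = (g z : ℂ)⁻¹ * (cf μ φ ψ g n z * (φ n).eval z + ee μ φ ψ g n z) := by
    have hg := g_ne s z
    field_simp
    rw [cf, ee]; linear_combination h
  have hc : conj ((g z : ℂ)⁻¹) = (g z : ℂ)⁻¹ := by simp
  simp only [Complex.ofReal_div, Complex.ofReal_pow, ← Complex.conj_mul']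
  rw [h', map_mul, map_add, map_mul, hc]
  simp only [FF]
  have e : ee μ φ ψ g n z = AB μ g (starPoly n (φ n)) (ψ n) z * (starPoly n (φ n)).eval z := rfl
  rw [div_eq_mul_inv]
  linear_combination (-(g z : ℂ)⁻¹ * conj (cf μ φ ψ g n z) * conj ((φ n).eval z)) * e

lemma VV_lim (hq : Tendsto (fun n => NP μ (qq φ n) / n) atTop (𝓝 0)) :
    Tendsto (VV μ φ ψ g) atTop (𝓝 0) := by
  have h1 := Apx.lam s.hS s.hW s.hz s.hα (FF_apx s) (FF_nice s)
  have h2 : Tendsto (fun n => ∫ z, conj ((ψ n).eval z) * ee μ φ ψ g n z ∂μ) atTop (𝓝 0) := by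
    have h3 := (SS_lim s hq).const_mul L
    rw [mul_zero] at h3
    refine squeeze_zero_norm' ?_ h3
    filter_upwards [eventually_ge_atTop 1] with n hn
    rw [u_eq s n hn]
    refine (N_cs' (Nice.poly (ψ n)).conj (SS_nice s n) s.hS).trans ?_
    have e : N μ (fun z => conj ((ψ n).eval z)) = NP μ (ψ n) := N_congr s.hS fun z _ => by simp
    rw [e]
    exact mul_le_mul_of_nonneg_right (s.hLψ n) (N_nonneg _)
  have h4 := (h2.sub h1).norm
  rw [sub_zero, norm_zero] at h4
  rw [tendsto_zero_iff_abs_tendsto_zero]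
  refine h4.congr fun n => ?_
  rw [← VV_eq s n, Complex.norm_real]; rfl

lemma final_bd (n : ℕ) (hn : 1 ≤ n) : ∫ z, g z * ‖(qq ψ n).eval z‖ ^ 2 ∂μ ≤
    n ^ 2 * (2 / c * N μ (SS μ φ ψ g n) ^ 2 + 2 * VV μ φ ψ g n) := by
  have hn0 : (n : ℂ) ≠ 0 := by exact_mod_cast (by omega : n ≠ 0)
  have hn1 : (0 : ℝ) < n := by exact_mod_cast hn
  have hc := s.hc
  have i2 : Integrable (fun z => ‖ee μ φ ψ g n z‖ ^ 2 / g z) μ := by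
    have := (((ee_nice s n).conj.mul (ee_nice s n)).mul (Nice.of_cont (ginv_cont s))).int s.hS
    have := this.re
    refine this.congr (ae_of_all _ fun z => ?_)
    have e : conj (ee μ φ ψ g n z) * ee μ φ ψ g n z * (g z : ℂ)⁻¹
      = ((‖ee μ φ ψ g n z‖ ^ 2 / g z : ℝ) : ℂ) := by
      push_cast; rw [Complex.conj_mul', div_eq_mul_inv]
    simp only [e]; simp only [RCLike.re_eq_complex_re, Complex.ofReal_re]
  rw [N_sq, VV, ← integral_const_mul, ← integral_const_mul, ← integral_add
    (((SS_nice s n).int_sq s.hS).const_mul _) (i2.const_mul _), ← integral_const_mul]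
  refine integral_mono_of_nonneg (ae_of_all _ fun z => ?_) (Integrable.const_mul
    ((((SS_nice s n).int_sq s.hS).const_mul _).add (i2.const_mul _)) _)
    (s.hS.mono fun z hz => ?_)
  · exact mul_nonneg (hc.le.trans (s.hgc z)) (by positivity)
  · have h := ident1 s n hz
    have hg0 : 0 < g z := hc.trans_le (s.hgc z)
    have e : (g z : ℂ) * (qq ψ n).eval z = n * (SS μ φ ψ g n z - ee μ φ ψ g n z) := by
      simp only [SS, ee, cf, qq, eval_sub, eval_mul, eval_C]
      field_simp
      linear_combination (-(n : ℂ)) * h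
    have e2 : g z * ‖(qq ψ n).eval z‖ = n * ‖SS μ φ ψ g n z - ee μ φ ψ g n z‖ := by
      have := congrArg norm e
      rwa [norm_mul, norm_mul, Complex.norm_real, Real.norm_of_nonneg hg0.le,
        RCLike.norm_natCast] at this
    have e3 : g z * ‖(qq ψ n).eval z‖ ^ 2 = n ^ 2 * (‖SS μ φ ψ g n z - ee μ φ ψ g n z‖ ^ 2 / g z) := by
      field_simp
      linear_combination (g z * ‖(qq ψ n).eval z‖ + n * ‖SS μ φ ψ g n z - ee μ φ ψ g n z‖) * e2
    simp only
    rw [e3]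
    refine mul_le_mul_of_nonneg_left ?_ (by positivity)
    have t := norm_sub_le (SS μ φ ψ g n z) (ee μ φ ψ g n z)
    have t2 : ‖SS μ φ ψ g n z - ee μ φ ψ g n z‖ ^ 2 ≤
        2 * ‖SS μ φ ψ g n z‖ ^ 2 + 2 * ‖ee μ φ ψ g n z‖ ^ 2 := by
      have := norm_nonneg (SS μ φ ψ g n z - ee μ φ ψ g n z)
      nlinarith [sq_nonneg (‖SS μ φ ψ g n z‖ - ‖ee μ φ ψ g n z‖)]
    calc ‖SS μ φ ψ g n z - ee μ φ ψ g n z‖ ^ 2 / g z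
        ≤ (2 * ‖SS μ φ ψ g n z‖ ^ 2 + 2 * ‖ee μ φ ψ g n z‖ ^ 2) / g z := by gcongr
      _ = 2 * ‖SS μ φ ψ g n z‖ ^ 2 / g z + 2 * (‖ee μ φ ψ g n z‖ ^ 2 / g z) := by ring
      _ ≤ 2 * ‖SS μ φ ψ g n z‖ ^ 2 / c + 2 * (‖ee μ φ ψ g n z‖ ^ 2 / g z) := by
          gcongr; exact s.hgc z
      _ = _ := by ring

lemma final (hq : Tendsto (fun n => NP μ (qq φ n) / n) atTop (𝓝 0)) :
    Tendsto (fun n : ℕ => (∫ z, g z * ‖(DD (ψ n)).eval z‖ ^ 2 ∂μ) / n ^ 2) atTop (𝓝 1) := by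
  have hre : ∀ P : ℂ[X], wip μ (fun z => (g z : ℂ)) P P = ((∫ z, g z * ‖P.eval z‖ ^ 2 ∂μ : ℝ) : ℂ) := by
    intro P
    rw [wip, ← integral_complex_ofReal]
    congr 1; ext z
    push_cast
    rw [Complex.conj_mul']
  have hp : ∀ n : ℕ, ∫ z, g z * ‖(DD (ψ n)).eval z‖ ^ 2 ∂μ =
      n ^ 2 + ∫ z, g z * ‖(qq ψ n).eval z‖ ^ 2 ∂μ := by
    intro n
    have := pyth (g_nice s) s.hS s.hψ n
    rw [hre, hre] at this
    exact_mod_cast this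
  have h1 := (((SS_lim s hq).pow 2).const_mul (2 / c)).add ((VV_lim s hq).const_mul 2)
  have h1 : Tendsto (fun n => 2 / c * N μ (SS μ φ ψ g n) ^ 2 + 2 * VV μ φ ψ g n) atTop (𝓝 0) := by
    simpa using h1
  have h2 : Tendsto (fun n : ℕ => (∫ z, g z * ‖(qq ψ n).eval z‖ ^ 2 ∂μ) / n ^ 2) atTop (𝓝 0) := by
    refine squeeze_zero' (Eventually.of_forall fun n => ?_) ?_ h1
    · refine div_nonneg (integral_nonneg fun z => ?_) (by positivity)
      exact mul_nonneg (s.hc.le.trans (s.hgc z)) (by positivity)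
    · filter_upwards [eventually_ge_atTop 1] with n hn
      have hn1 : (0 : ℝ) < n := by exact_mod_cast hn
      rw [div_le_iff₀ (by positivity), mul_comm]
      exact final_bd s n hn
  have h3 := h2.const_add 1
  rw [add_zero] at h3
  refine h3.congr' ?_
  filter_upwards [eventually_ge_atTop 1] with n hn
  have hn1 : (0 : ℝ) < n := by exact_mod_cast hn
  rw [hp n, add_div, div_self (by positivity)]

end setup

lemma l2_DD {ν : Measure ℂ} (hS : ∀ᵐ z ∂ν, ‖z‖ = 1) (P : ℂ[X]) (n : ℕ) :
    l2norm ν (derivative P) / n = Real.sqrt ((∫ z, ‖(DD P).eval z‖ ^ 2 ∂ν) / n ^ 2) := by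
  have e : ∫ z, ‖(derivative P).eval z‖ ^ 2 ∂ν = ∫ z, ‖(DD P).eval z‖ ^ 2 ∂ν :=
    integral_congr_ae (hS.mono fun z hz => by simp [DD, hz])
  rw [l2norm, e, Real.sqrt_div (integral_nonneg fun z => by positivity), Real.sqrt_sq (by positivity),
    Real.sqrt_eq_rpow]

lemma hyp_q (hS : ∀ᵐ z ∂μ, ‖z‖ = 1) {φ : ℕ → ℂ[X]} (hW : WOP μ 1 φ) (h : NormalBehavior μ φ) :
    Tendsto (fun n => NP μ (qq φ n) / n) atTop (𝓝 0) := by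
  have hp : ∀ n : ℕ, ∫ z, ‖(DD (φ n)).eval z‖ ^ 2 ∂μ = n ^ 2 + NP μ (qq φ n) ^ 2 := by
    intro n
    have := pyth nice_one hS hW n
    rw [← NP_sq, ← NP_sq] at this
    have h2 : NP μ (DD (φ n)) ^ 2 = n ^ 2 + NP μ (qq φ n) ^ 2 := by exact_mod_cast this
    rw [← h2, NP, N_sq]
  have h1 := (h.pow 2).sub_const 1
  have h2 : Tendsto (fun n => (NP μ (qq φ n) / n) ^ 2) atTop (𝓝 0) := by
    rw [one_pow, sub_self] at h1
    refine h1.congr' ?_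
    filter_upwards [eventually_ge_atTop 1] with n hn
    have hn1 : (0 : ℝ) < n := by exact_mod_cast hn
    have := NP_nonneg (μ := μ) (qq φ n)
    rw [l2_DD hS, hp, Real.sq_sqrt (by positivity)]
    field_simp; ring
  have h3 := h2.sqrt
  rw [Real.sqrt_zero] at h3
  refine h3.congr fun n => Real.sqrt_sq (div_nonneg (NP_nonneg _) (by positivity))

theorem main (hcirc : OnCircle μ)
    (φ : ℕ → Polynomial ℂ) (hφ : IsOPUC μ φ)
    (hnevai : Tendsto (fun n : ℕ => verblunsky φ n) atTop (𝓝 0))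
    (g₀ : ℂ → ℝ) (K : NNReal) (hg₀ : LipschitzOnWith K g₀ (Metric.sphere (0 : ℂ) 1))
    (hgpos : ∀ z ∈ Metric.sphere (0 : ℂ) 1, 0 < g₀ z)
    (ψ : ℕ → Polynomial ℂ)
    (hψ : IsOPUC (μ.withDensity fun z => ENNReal.ofReal (g₀ z)) ψ)
    (hnormal : NormalBehavior μ φ) :
    NormalBehavior (μ.withDensity fun z => ENNReal.ofReal (g₀ z)) ψ := by
  have hS : ∀ᵐ z ∂μ, ‖z‖ = 1 := by
    refine (ae_iff.2 ?_)
    rw [← hcirc.symm.symm]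
    congr 1; ext z; simp
  have hne : (Metric.sphere (0 : ℂ) 1).Nonempty := ⟨1, by simp⟩
  obtain ⟨z0, hz0, hmin⟩ := (isCompact_sphere (0 : ℂ) 1).exists_isMinOn hne hg₀.continuousOn
  obtain ⟨z1, hz1, hmax⟩ := (isCompact_sphere (0 : ℂ) 1).exists_isMaxOn hne hg₀.continuousOn
  have hcpos : 0 < g₀ z0 := hgpos z0 hz0
  obtain ⟨g₁, hg₁, heq⟩ := hg₀.extend_real
  set g : ℂ → ℝ := fun z => max (g₁ z) (g₀ z0) with hgdef
  have hgL : LipschitzWith K g := hg₁.max_const _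
  have hgeq : ∀ z, ‖z‖ = 1 → g z = g₀ z := by
    intro z hz
    have hz' : z ∈ Metric.sphere (0 : ℂ) 1 := by simpa using hz
    simp only [hgdef]
    rw [← heq hz', max_eq_left (hmin hz')]
  have hgc : ∀ z, g₀ z0 ≤ g z := fun z => le_max_right _ _
  have hgp : ∀ z, 0 < g z := fun z => hcpos.trans_le (hgc z)
  have hν : (μ.withDensity fun z => ENNReal.ofReal (g₀ z)) =
      μ.withDensity fun z => ENNReal.ofReal (g z) :=
    withDensity_congr_ae (hS.mono fun z hz => by simp only [hgeq z hz])
  rw [hν] at hψ ⊢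
  have hmeas : Measurable g := hgL.continuous.measurable
  have hint : ∀ f : ℂ → ℂ, ∫ z, f z ∂(μ.withDensity fun z => ENNReal.ofReal (g z)) =
      ∫ z, (g z : ℂ) * f z ∂μ := by
    intro f
    rw [integral_withDensity_eq_integral_toReal_smul₀ hmeas.ennreal_ofReal.aemeasurable
      (ae_of_all _ fun z => ENNReal.ofReal_lt_top)]
    congr 1; ext z
    rw [ENNReal.toReal_ofReal (hgp z).le, Complex.real_smul]
  have hintr : ∀ f : ℂ → ℝ, ∫ z, f z ∂(μ.withDensity fun z => ENNReal.ofReal (g z)) =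
      ∫ z, g z * f z ∂μ := by
    intro f
    rw [integral_withDensity_eq_integral_toReal_smul₀ hmeas.ennreal_ofReal.aemeasurable
      (ae_of_all _ fun z => ENNReal.ofReal_lt_top)]
    congr 1; ext z
    rw [ENNReal.toReal_ofReal (hgp z).le, smul_eq_mul]
  have hSν : ∀ᵐ z ∂(μ.withDensity fun z => ENNReal.ofReal (g z)), ‖z‖ = 1 :=
    (withDensity_absolutelyContinuous _ _).ae_le hS
  have hWψ : WOP μ (fun z => (g z : ℂ)) ψ := ⟨hψ.deg, fun m n => by
    rw [← hψ.orth m n, hint]; rfl⟩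
  have hW : WOP μ 1 φ := ⟨hφ.deg, fun m n => by rw [← hφ.orth m n]; simp [wip]⟩
  obtain ⟨ρ, hz⟩ := szego hS hφ
  have hLψ : ∀ n, NP μ (ψ n) ≤ Real.sqrt (1 / g₀ z0) := by
    intro n
    refine Real.sqrt_le_sqrt ?_
    rw [le_div_iff₀ hcpos, mul_comm, ← integral_const_mul]
    have h1 : ∫ z, g z * ‖(ψ n).eval z‖ ^ 2 ∂μ = 1 := by
      have := hWψ.orth n n
      rw [if_pos rfl, wip] at this
      have e : ((∫ z, g z * ‖(ψ n).eval z‖ ^ 2 ∂μ : ℝ) : ℂ) = 1 := by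
        rw [← this, ← integral_complex_ofReal]
        congr 1; ext z
        push_cast; rw [Complex.conj_mul']
      exact_mod_cast e
    rw [← h1]
    have hgi : Integrable (fun z => g z * ‖(ψ n).eval z‖ ^ 2) μ := by
      have := (wip_int (Nice.of_cont (Complex.continuous_ofReal.comp hgL.continuous)) hS
        (ψ n) (ψ n)).re
      refine this.congr (ae_of_all _ fun z => ?_)
      have e : ((g z : ℝ) : ℂ) * (conj ((ψ n).eval z) * (ψ n).eval z) =
          ((g z * ‖(ψ n).eval z‖ ^ 2 : ℝ) : ℂ) := by
        push_cast; rw [Complex.conj_mul']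
      simp only [Function.comp_apply, e]
      simp only [RCLike.re_eq_complex_re, Complex.ofReal_re]
    refine integral_mono (((Nice.poly (ψ n)).int_sq hS).const_mul _) hgi fun z => ?_
    exact mul_le_mul_of_nonneg_right (hgc z) (by positivity)
  have s : Setup μ φ ψ ρ (verblunsky φ) g (g₀ z0) (g₀ z1) K (Real.sqrt (1 / g₀ z0)) :=
    { hS := hS, hW := hW, hz := hz, hα := hnevai, hg := hgL.continuous, hc := hcpos, hgc := hgc
      hgM := fun z hz => by
        rw [hgeq z hz]; exact hmax (by simpa using hz)
      hK := K.2
      hgK := fun z w => by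
        have := hgL.dist_le_mul z w
        rwa [Real.dist_eq, dist_eq_norm] at this
      hψ := hWψ, hL := Real.sqrt_nonneg _, hLψ := hLψ }
  have h := (final s (hyp_q hS hW hnormal)).sqrt
  rw [Real.sqrt_one] at h
  refine h.congr fun n => ?_
  rw [l2_DD hSν, hintr]

end OPH

/-- If `μ` obeys the Nevai condition and `g` is Lipschitz and
strictly positive on `∂𝔻`, then normality of `μ` implies normality of `g dμ`. -/
theorem stmt16 (μ : Measure ℂ) [IsProbabilityMeasure μ] (hcirc : OnCircle μ)
    (hnt : NontrivialSupport μ) (φ : ℕ → Polynomial ℂ) (hφ : IsOPUC μ φ)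
    (hnevai : Tendsto (fun n : ℕ => verblunsky φ n) atTop (𝓝 0))
    (g : ℂ → ℝ) (K : NNReal) (hg : LipschitzOnWith K g (Metric.sphere (0 : ℂ) 1))
    (hgpos : ∀ z ∈ Metric.sphere (0 : ℂ) 1, 0 < g z)
    (ψ : ℕ → Polynomial ℂ)
    (hψ : IsOPUC (μ.withDensity fun z => ENNReal.ofReal (g z)) ψ)
    (hnormal : NormalBehavior μ φ) :
    NormalBehavior (μ.withDensity fun z => ENNReal.ofReal (g z)) ψ := by
  exact OPH.main hcirc φ hφ hnevai g K hg hgpos ψ hψ hnormal
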